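/- arXiv:0811.3896 — 8 statements merged into one kernel-verified Lean document; each statement's English description precedes it below -/
import Mathlib

section
/- Let ξ : ℝ² → ℝ² be the linear map ξ(x,y) = (x + y/√3, 2y/√3). If D is a DD*(m,r) (a set of m points of the hexagonal grid Λ_H with all pairwise differences between distinct points distinct, and pairwise Euclidean distances at most r), then ξ(D) is a DD(m, r√2) (a set of m points of ℤ² with all pairwise differences between distinct points distinct, and pairwise Euclidean distances at most r√2). Conversely, if D′ is a DD(m,r) in ℤ², then ξ⁻¹(D′) is a DD*(m, r√(3/2)) in Λ_H. -/
/-- The linear map ξ(x,y) = (x + y/√3, 2y/√3). -/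
noncomputable def xi : ℝ × ℝ → ℝ × ℝ :=
  fun p => (p.1 + p.2 / Real.sqrt 3, 2 * p.2 / Real.sqrt 3)

/-- The inverse map ξ⁻¹(x,y) = (x − y/2, √3·y/2). -/
noncomputable def xiInv : ℝ × ℝ → ℝ × ℝ :=
  fun p => (p.1 - p.2 / 2, Real.sqrt 3 * p.2 / 2)

/-- The hexagonal grid Λ_H = {λ(1,0) + μ(−1/2, √3/2) : λ, μ ∈ ℤ}. -/
def hexGrid : Set (ℝ × ℝ) :=
  {p | ∃ l μ : ℤ, p = (l : ℝ) • ((1 : ℝ), (0 : ℝ)) + (μ : ℝ) • (-(1 / 2 : ℝ), Real.sqrt 3 / 2)}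

/-- The square grid ℤ², viewed inside ℝ². -/
def intGrid : Set (ℝ × ℝ) := {p | ∃ a b : ℤ, p = ((a : ℝ), (b : ℝ))}

/-- All differences of distinct pairs of points of `D` are pairwise distinct. -/
def HasDistinctDifferences {G : Type*} [AddCommGroup G] (D : Set G) : Prop :=
  ∀ v ∈ D, ∀ w ∈ D, ∀ v' ∈ D, ∀ w' ∈ D,
    v ≠ w → v' ≠ w' → v - w = v' - w' → v = v' ∧ w = w'

/-- The Euclidean distance between two points of ℝ². -/
noncomputable def euclDist (p q : ℝ × ℝ) : ℝ :=
  Real.sqrt ((p.1 - q.1) ^ 2 + (p.2 - q.2) ^ 2)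

theorem xi_sub (p q : ℝ × ℝ) : xi (p - q) = xi p - xi q := by
  ext <;> simp only [xi, Prod.fst_sub, Prod.snd_sub] <;> ring

theorem xiInv_sub (p q : ℝ × ℝ) : xiInv (p - q) = xiInv p - xiInv q := by
  ext <;> simp only [xiInv, Prod.fst_sub, Prod.snd_sub] <;> ring

theorem xiInv_leftInverse : Function.LeftInverse xiInv xi := by
  intro p
  ext <;> simp only [xi, xiInv] <;> field

theorem xiInv_rightInverse : Function.RightInverse xiInv xi := by
  intro p
  ext <;> simp only [xi, xiInv] <;> field

theorem xi_mem_intGrid {p : ℝ × ℝ} (hp : p ∈ hexGrid) : xi p ∈ intGrid := by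
  obtain ⟨l, μ, rfl⟩ := hp
  refine ⟨l, μ, ?_⟩
  ext <;> simp [xi] <;> field

theorem xiInv_mem_hexGrid {p : ℝ × ℝ} (hp : p ∈ intGrid) : xiInv p ∈ hexGrid := by
  obtain ⟨a, b, rfl⟩ := hp
  refine ⟨a, b, ?_⟩
  ext <;> simp [xiInv] <;> ring

theorem HasDistinctDifferences.image {G H : Type*} [AddCommGroup G] [AddCommGroup H]
    {D : Set G} (hD : HasDistinctDifferences D) {f : G → H} (hf : Function.Injective f)
    (hsub : ∀ p q, f (p - q) = f p - f q) : HasDistinctDifferences (f '' D) := by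
  rintro _ ⟨v, hv, rfl⟩ _ ⟨w, hw, rfl⟩ _ ⟨v', hv', rfl⟩ _ ⟨w', hw', rfl⟩ hvw hvw' h
  rw [← hsub, ← hsub] at h
  obtain ⟨rfl, rfl⟩ := hD v hv w hw v' hv' w' hw' (ne_of_apply_ne f hvw)
    (ne_of_apply_ne f hvw') (hf h)
  exact ⟨rfl, rfl⟩

theorem euclDist_xi_le (p q : ℝ × ℝ) : euclDist (xi p) (xi q) ≤ euclDist p q * √2 := by
  rw [euclDist, euclDist, ← Real.sqrt_mul (by positivity)]
  apply Real.sqrt_le_sqrt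
  have h3 : (√3)⁻¹ ^ 2 = 1 / 3 := by norm_num
  simp only [xi, div_eq_mul_inv]
  linear_combination
    sq_nonneg ((p.1 - q.1) - (p.2 - q.2) * (√3)⁻¹) + 6 * (p.2 - q.2) ^ 2 * h3

theorem euclDist_xiInv_le (p q : ℝ × ℝ) :
    euclDist (xiInv p) (xiInv q) ≤ euclDist p q * √(3 / 2) := by
  rw [euclDist, euclDist, ← Real.sqrt_mul (by positivity)]
  apply Real.sqrt_le_sqrt
  have h3 : √3 ^ 2 = 3 := by norm_num
  simp only [xiInv]
  linear_combination
    1 / 2 * sq_nonneg ((p.1 - q.1) + (p.2 - q.2)) + (p.2 - q.2) ^ 2 / 4 * h3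

/-- Images of distinct difference configurations under an injective map respecting differences,
mapping the grid `A` into the grid `B` and stretching distances by a factor at most `c`. -/
theorem distinctDifferenceConfiguration_image {f : ℝ × ℝ → ℝ × ℝ} {A B : Set (ℝ × ℝ)} {c r : ℝ}
    (hf : Function.Injective f) (hsub : ∀ p q, f (p - q) = f p - f q)
    (hAB : ∀ p ∈ A, f p ∈ B) (hc : 0 ≤ c)
    (hdist : ∀ p q, euclDist (f p) (f q) ≤ euclDist p q * c)
    {D : Finset (ℝ × ℝ)} (hDA : ↑D ⊆ A) (hD : HasDistinctDifferences (D : Set (ℝ × ℝ)))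
    (hDr : ∀ v ∈ D, ∀ w ∈ D, euclDist v w ≤ r) :
    (D.image f).card = D.card ∧ ↑(D.image f) ⊆ B ∧
      HasDistinctDifferences (↑(D.image f) : Set (ℝ × ℝ)) ∧
      ∀ v ∈ D.image f, ∀ w ∈ D.image f, euclDist v w ≤ r * c := by
  refine ⟨Finset.card_image_of_injective D hf, ?_, ?_, ?_⟩
  · rw [Finset.coe_image]
    rintro _ ⟨p, hp, rfl⟩
    exact hAB p (hDA hp)
  · rw [Finset.coe_image]
    exact hD.image hf hsub
  · simp only [Finset.forall_mem_image]
    intro v hv w hw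
    exact (hdist v w).trans (mul_le_mul_of_nonneg_right (hDr v hv w hw) hc)

theorem stmt1 (m : ℕ) (r : ℝ) (hr : 0 < r) :
    (∀ D : Finset (ℝ × ℝ), D.card = m → ↑D ⊆ hexGrid →
      HasDistinctDifferences (↑D : Set (ℝ × ℝ)) →
      (∀ v ∈ D, ∀ w ∈ D, euclDist v w ≤ r) →
      ((D.image xi).card = m ∧ ↑(D.image xi) ⊆ intGrid ∧
        HasDistinctDifferences (↑(D.image xi) : Set (ℝ × ℝ)) ∧
        (∀ v ∈ D.image xi, ∀ w ∈ D.image xi, euclDist v w ≤ r * Real.sqrt 2))) ∧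
    (∀ D' : Finset (ℝ × ℝ), D'.card = m → ↑D' ⊆ intGrid →
      HasDistinctDifferences (↑D' : Set (ℝ × ℝ)) →
      (∀ v ∈ D', ∀ w ∈ D', euclDist v w ≤ r) →
      ((D'.image xiInv).card = m ∧ ↑(D'.image xiInv) ⊆ hexGrid ∧
        HasDistinctDifferences (↑(D'.image xiInv) : Set (ℝ × ℝ)) ∧
        (∀ v ∈ D'.image xiInv, ∀ w ∈ D'.image xiInv,
          euclDist v w ≤ r * Real.sqrt (3 / 2)))) := by
  constructor
  · rintro D rfl hDA hD hDr
    exact distinctDifferenceConfiguration_image xiInv_leftInverse.injective xi_sub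
      (fun _ => xi_mem_intGrid) (Real.sqrt_nonneg _) euclDist_xi_le hDA hD hDr
  · rintro D rfl hDA hD hDr
    exact distinctDifferenceConfiguration_image xiInv_rightInverse.injective xiInv_sub
      (fun _ => xiInv_mem_hexGrid) (Real.sqrt_nonneg _) euclDist_xiInv_le hDA hD hDr
end

section
/- Let D = {v₁,…,v_m} be a set of m points in ℤ² whose pairwise differences between distinct points are all distinct (a DD(m)), and let k be a positive integer. Then C_k(D) ≤ ∑_{i=1}^k |H_i|, with equality if and only if the vectors ∑_{i=1}^m a_i v_i, as (a₁,…,a_m) ranges over ⋃_{j=0}^k H_j, are pairwise distinct. -/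
/-- The set of nonzero elements expressible as a sum of at most `k` difference
vectors of `D`. -/
def khopSet {G : Type*} [AddCommGroup G] (D : Set G) (k : ℕ) : Set G :=
  {x | x ≠ 0 ∧ ∃ ℓ : ℕ, ℓ ≤ k ∧ ∃ a b : Fin ℓ → G,
    (∀ i, a i ∈ D ∧ b i ∈ D ∧ a i ≠ b i) ∧ x = ∑ i, (a i - b i)}

/-- `Ck D k` is the `k`-hop coverage of `D`. -/
noncomputable def Ck {G : Type*} [AddCommGroup G] (D : Set G) (k : ℕ) : ℕ :=
  (khopSet D k).ncard

/-- `H m k` is the set of m-tuples of integers summing to 0 whose positive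
entries sum to `k`. -/
def H (m k : ℕ) : Set (Fin m → ℤ) :=
  {a | ∑ i, a i = 0 ∧ ∑ i ∈ Finset.univ.filter (fun i => 0 < a i), a i = (k : ℤ)}

theorem mem_H_iff {m k : ℕ} {a : Fin m → ℤ} :
    a ∈ H m k ↔ ∑ i, a i = 0 ∧ ∑ i, max (a i) 0 = (k : ℤ) := by
  have h : ∑ i ∈ Finset.univ.filter (fun i => 0 < a i), a i = ∑ i, max (a i) 0 := by
    rw [Finset.sum_filter]
    refine Finset.sum_congr rfl fun i _ => ?_
    split_ifs <;> omega
  rw [← h]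
  rfl

theorem sum_max_neg_eq {m k : ℕ} {a : Fin m → ℤ} (ha : a ∈ H m k) :
    ∑ i, max (-a i) 0 = (k : ℤ) := by
  obtain ⟨h0, hk⟩ := mem_H_iff.1 ha
  have h : ∑ i, max (-a i) 0 = ∑ i, max (a i) 0 - ∑ i, a i := by
    rw [← Finset.sum_sub_distrib]
    exact Finset.sum_congr rfl fun i _ => by omega
  rw [h, h0, hk, sub_zero]

theorem finite_H (m k : ℕ) : (H m k).Finite := by
  refine (Set.finite_Icc (fun _ : Fin m => -(k : ℤ)) (fun _ => (k : ℤ))).subset fun a ha => ?_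
  have hneg := sum_max_neg_eq ha
  have hpos := (mem_H_iff.1 ha).2
  refine ⟨fun i => ?_, fun i => ?_⟩
  · have := Finset.single_le_sum (f := fun i => max (-a i) 0)
      (fun i _ => le_max_right _ _) (Finset.mem_univ i)
    simp only at this ⊢
    omega
  · have := Finset.single_le_sum (f := fun i => max (a i) 0)
      (fun i _ => le_max_right _ _) (Finset.mem_univ i)
    simp only at this ⊢
    omega

theorem pairwise_disjoint_H (m : ℕ) : Pairwise (Function.onFun Disjoint (H m)) := by
  intro i j hij
  refine Set.disjoint_left.2 fun a hi hj => hij ?_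
  have := (mem_H_iff.1 hi).2.symm.trans (mem_H_iff.1 hj).2
  exact_mod_cast this

theorem H_zero (m : ℕ) : H m 0 = {0} := by
  ext a
  rw [Set.mem_singleton_iff]
  constructor
  · intro ha
    have hneg := sum_max_neg_eq ha
    have hpos := (mem_H_iff.1 ha).2
    rw [Nat.cast_zero, Finset.sum_eq_zero_iff_of_nonneg fun i _ => le_max_right _ _] at hneg hpos
    funext i
    have h1 := hneg i (Finset.mem_univ i)
    have h2 := hpos i (Finset.mem_univ i)
    simp only [Pi.zero_apply]
    omega
  · rintro rfl
    simp [mem_H_iff]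

theorem sub_single_mem_H {m k : ℕ} {a : Fin m → ℤ} (ha : a ∈ H m (k + 1)) {p q : Fin m}
    (hp : 0 < a p) (hq : a q < 0) : a - Pi.single p 1 + Pi.single q 1 ∈ H m k := by
  obtain ⟨h0, hk⟩ := mem_H_iff.1 ha
  rw [mem_H_iff]
  constructor
  · simp [Finset.sum_add_distrib, h0]
  · have h : ∑ i, max ((a - Pi.single p 1 + Pi.single q 1 : Fin m → ℤ) i) 0
        = ∑ i, (max (a i) 0 - (Pi.single p 1 : Fin m → ℤ) i) := by
      refine Finset.sum_congr rfl fun i _ => ?_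
      simp only [Pi.add_apply, Pi.sub_apply, Pi.single_apply]
      split_ifs <;> subst_vars <;> omega
    rw [h, Finset.sum_sub_distrib, hk]
    simp

/-- A tuple in `H m k` is a sum of `k` differences of standard basis vectors, so the combination
of the `v i` it describes is a sum of `k` differences. -/
theorem exists_sum_sub_eq {G : Type*} [AddCommGroup G] {m : ℕ} (v : Fin m → G) {k : ℕ} :
    ∀ {a : Fin m → ℤ}, a ∈ H m k → ∃ p q : Fin k → Fin m,
      (∀ t, p t ≠ q t) ∧ ∑ i, a i • v i = ∑ t, (v (p t) - v (q t)) := by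
  induction k with
  | zero =>
    intro a ha
    rw [H_zero, Set.mem_singleton_iff] at ha
    exact ⟨Fin.elim0, Fin.elim0, fun t => t.elim0, by simp [ha]⟩
  | succ k ih =>
    intro a ha
    obtain ⟨p, -, hp⟩ : ∃ p ∈ Finset.univ, 0 < max (a p) 0 := by
      refine Finset.exists_lt_of_sum_lt (f := fun _ => 0) ?_
      rw [(mem_H_iff.1 ha).2, Finset.sum_const_zero]
      positivity
    obtain ⟨q, -, hq⟩ : ∃ q ∈ Finset.univ, 0 < max (-a q) 0 := by
      refine Finset.exists_lt_of_sum_lt (f := fun _ => 0) ?_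
      rw [sum_max_neg_eq ha, Finset.sum_const_zero]
      positivity
    have hp' : 0 < a p := by omega
    have hq' : a q < 0 := by omega
    obtain ⟨p', q', hne, heq⟩ := ih (sub_single_mem_H ha hp' hq')
    refine ⟨Fin.cons p p', Fin.cons q q', Fin.forall_fin_succ.2 ⟨?_, ?_⟩, ?_⟩
    · simp only [Fin.cons_zero]
      rintro rfl
      omega
    · simpa using hne
    · rw [Fin.sum_univ_succ]
      simp only [Fin.cons_zero, Fin.cons_succ]
      rw [← heq]
      simp [add_smul, sub_smul, Finset.sum_add_distrib, Pi.single_apply, ite_smul]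

theorem exists_mem_H_sum_sub_eq {G : Type*} [AddCommGroup G] {m : ℕ} (v : Fin m → G) {ℓ : ℕ}
    (p q : Fin ℓ → Fin m) :
    ∃ j ≤ ℓ, ∃ a ∈ H m j, ∑ i, a i • v i = ∑ t, (v (p t) - v (q t)) := by
  let P : Fin m → ℤ := fun i => ∑ t, (Pi.single (p t) 1 : Fin m → ℤ) i
  let Q : Fin m → ℤ := fun i => ∑ t, (Pi.single (q t) 1 : Fin m → ℤ) i
  have hnonneg : ∀ (r s : Fin m), 0 ≤ (Pi.single r 1 : Fin m → ℤ) s := fun r s => by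
    rw [Pi.single_apply]; split_ifs <;> norm_num
  have hP : ∀ i, 0 ≤ P i := fun i => Finset.sum_nonneg fun t _ => hnonneg _ _
  have hQ : ∀ i, 0 ≤ Q i := fun i => Finset.sum_nonneg fun t _ => hnonneg _ _
  have hsum : ∀ r : Fin ℓ → Fin m, ∑ i, ∑ t, (Pi.single (r t) 1 : Fin m → ℤ) i = ℓ := fun r => by
    rw [Finset.sum_comm]
    simp
  have hsmul : ∀ r : Fin ℓ → Fin m,
      ∑ i, (∑ t, (Pi.single (r t) 1 : Fin m → ℤ) i) • v i = ∑ t, v (r t) := fun r => by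
    simp_rw [Finset.sum_smul]
    rw [Finset.sum_comm]
    simp [Pi.single_apply, ite_smul]
  have hle : ∑ i, max (P i - Q i) 0 ≤ (ℓ : ℤ) := by
    rw [← hsum p]
    refine Finset.sum_le_sum fun i _ => ?_
    have h1 := hP i
    have h2 := hQ i
    change max (P i - Q i) 0 ≤ P i
    omega
  have h0 : 0 ≤ ∑ i, max (P i - Q i) 0 := Finset.sum_nonneg fun i _ => le_max_right _ _
  refine ⟨(∑ i, max (P i - Q i) 0).toNat, by omega, fun i => P i - Q i, ?_, ?_⟩
  · refine mem_H_iff.2 ⟨?_, (Int.toNat_of_nonneg h0).symm⟩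
    rw [Finset.sum_sub_distrib, hsum p, hsum q, sub_self]
  · simp_rw [sub_smul]
    rw [Finset.sum_sub_distrib, Finset.sum_sub_distrib, hsmul p, hsmul q]

theorem khopSet_range_eq {G : Type*} [AddCommGroup G] {m : ℕ} {v : Fin m → G}
    (hinj : Function.Injective v) (k : ℕ) :
    khopSet (Set.range v) k =
      (fun a : Fin m → ℤ => ∑ i, a i • v i) '' (⋃ j ∈ Finset.Icc 0 k, H m j) \ {0} := by
  ext x
  constructor
  · rintro ⟨hx, ℓ, hℓ, a, b, hab, rfl⟩
    choose p hp using fun t => (hab t).1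
    choose q hq using fun t => (hab t).2.1
    obtain ⟨j, hj, c, hc, hsum⟩ := exists_mem_H_sum_sub_eq v p q
    refine ⟨⟨c, Set.mem_biUnion (Finset.mem_Icc.2 ⟨j.zero_le, hj.trans hℓ⟩) hc, ?_⟩, hx⟩
    simpa only [hp, hq] using hsum
  · rintro ⟨⟨c, hc, rfl⟩, hx⟩
    simp only [Set.mem_iUnion, Finset.mem_Icc] at hc
    obtain ⟨j, ⟨-, hj⟩, hc⟩ := hc
    obtain ⟨p, q, hne, hsum⟩ := exists_sum_sub_eq v hc
    exact ⟨hx, j, hj, fun t => v (p t), fun t => v (q t),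
      fun t => ⟨⟨_, rfl⟩, ⟨_, rfl⟩, hinj.ne (hne t)⟩, hsum⟩

theorem finite_biUnion_H (m k : ℕ) : (⋃ j ∈ Finset.Icc 0 k, H m j).Finite :=
  (Finset.Icc 0 k).finite_toSet.biUnion fun j _ => finite_H m j

theorem ncard_biUnion_H (m k : ℕ) :
    (⋃ j ∈ Finset.Icc 0 k, H m j).ncard = ∑ j ∈ Finset.Icc 1 k, (H m j).ncard + 1 := by
  have h : (⋃ j ∈ Finset.Icc 0 k, H m j).ncard = ∑ j ∈ Finset.Icc 0 k, (H m j).ncard := by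
    rw [← finsum_mem_coe_finset]
    exact (Finset.finite_toSet _).ncard_biUnion (fun j _ => finite_H m j)
      ((pairwise_disjoint_H m).set_pairwise _)
  rw [h, ← Finset.add_sum_Ioc_eq_sum_Icc k.zero_le, H_zero, Set.ncard_singleton, add_comm]
  rfl

theorem stmt7 (m k : ℕ) (hk : 1 ≤ k) (v : Fin m → ℤ × ℤ) (hinj : Function.Injective v)
    (hdd : HasDistinctDifferences (Set.range v)) :
    Ck (Set.range v) k ≤ ∑ i ∈ Finset.Icc 1 k, (H m i).ncard ∧
    (Ck (Set.range v) k = ∑ i ∈ Finset.Icc 1 k, (H m i).ncard ↔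
      Set.InjOn (fun a : Fin m → ℤ => ∑ i, a i • v i)
        (⋃ j ∈ Finset.Icc 0 k, H m j)) := by
  have hfin := finite_biUnion_H m k
  have hzero : (0 : ℤ × ℤ) ∈ (fun a : Fin m → ℤ => ∑ i, a i • v i) ''
      (⋃ j ∈ Finset.Icc 0 k, H m j) :=
    ⟨0, Set.mem_biUnion (Finset.mem_Icc.2 ⟨le_rfl, k.zero_le⟩) (by rw [H_zero]; rfl), by simp⟩
  have hCk := Set.ncard_sdiff_singleton_add_one hzero (hfin.image _)
  rw [← khopSet_range_eq hinj] at hCk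
  have hle := Set.ncard_image_le (f := fun a : Fin m → ℤ => ∑ i, a i • v i) hfin
  rw [← Set.ncard_image_iff hfin]
  have hU := ncard_biUnion_H m k
  unfold Ck
  omega
end

section
/- Let D be a set of m points in ℤ² whose pairwise differences between distinct points are all distinct (a DD(m)). Then the two-hop coverage satisfies C₂(D) ≤ (1/4)·m(m−1)(m−2)(m−3) + m(m−1)(m−2) + 2m(m−1) = (1/4)·m(m−1)(m² − m + 6). -/
/-- A finite set containing every element reachable in at most two hops: it lists the differences,
their doubles, and the remaining two-hop sums by which of the four points coincide. -/
def twoHopCover {G : Type*} [AddCommGroup G] [DecidableEq G] (D : Finset G) : Finset G :=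
  ((D.powersetCard 2).sigma fun P => (D \ P).powersetCard 2).image
      (fun s => ∑ x ∈ s.1, x - ∑ x ∈ s.2, x) ∪
    ((D.sigma fun a => (D.erase a).powersetCard 2).image (fun s => s.1 + s.1 - ∑ x ∈ s.2, x) ∪
    ((D.sigma fun a => (D.erase a).powersetCard 2).image (fun s => ∑ x ∈ s.2, x - (s.1 + s.1)) ∪
    (D.offDiag.image (fun p => p.1 - p.2) ∪
      D.offDiag.image (fun p => (p.1 + p.1) - (p.2 + p.2)))))

theorem sub_mem_twoHopCover {G : Type*} [AddCommGroup G] [DecidableEq G] {D : Finset G} {a b : G}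
    (ha : a ∈ D) (hb : b ∈ D) (hab : a ≠ b) : a - b ∈ twoHopCover D := by
  simp only [twoHopCover, Finset.mem_union]
  exact .inr <| .inr <| .inr <| .inl <|
    Finset.mem_image.2 ⟨(a, b), Finset.mem_offDiag.2 ⟨ha, hb, hab⟩, rfl⟩

theorem sub_add_sub_mem_twoHopCover {G : Type*} [AddCommGroup G] [DecidableEq G] {D : Finset G}
    {a b c d : G} (ha : a ∈ D) (hb : b ∈ D) (hc : c ∈ D) (hd : d ∈ D) (hab : a ≠ b) (hcd : c ≠ d)
    (h0 : a - b + (c - d) ≠ 0) : a - b + (c - d) ∈ twoHopCover D := by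
  by_cases had : a = d
  · subst had
    have h : a - b + (c - a) = c - b := by abel
    rw [h] at h0 ⊢
    exact sub_mem_twoHopCover hc hb (sub_ne_zero.1 h0)
  by_cases hbc : b = c
  · subst hbc
    have h : a - b + (b - d) = a - d := by abel
    rw [h]
    exact sub_mem_twoHopCover ha hd had
  simp only [twoHopCover, Finset.mem_union, Finset.mem_image]
  by_cases hac : a = c
  · subst hac
    by_cases hbd : b = d
    · subst hbd
      exact .inr <| .inr <| .inr <| .inr ⟨(a, b), Finset.mem_offDiag.2 ⟨ha, hb, hab⟩, by
        dsimp only; abel⟩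
    · refine .inr <| .inl ⟨⟨a, {b, d}⟩, ?_, ?_⟩
      · simp only [Finset.mem_sigma, Finset.mem_powersetCard]
        exact ⟨ha, by grind, Finset.card_pair hbd⟩
      · dsimp only
        rw [Finset.sum_pair hbd]
        abel
  · by_cases hbd : b = d
    · subst hbd
      refine .inr <| .inr <| .inl ⟨⟨b, {a, c}⟩, ?_, ?_⟩
      · simp only [Finset.mem_sigma, Finset.mem_powersetCard]
        exact ⟨hb, by grind, Finset.card_pair hac⟩
      · dsimp only
        rw [Finset.sum_pair hac]
        abel
    · refine .inl ⟨⟨{a, c}, {b, d}⟩, ?_, ?_⟩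
      · simp only [Finset.mem_sigma, Finset.mem_powersetCard]
        exact ⟨⟨by grind, Finset.card_pair hac⟩, by grind, Finset.card_pair hbd⟩
      · dsimp only
        rw [Finset.sum_pair hac, Finset.sum_pair hbd]
        abel

theorem khopSet_two_subset_twoHopCover {G : Type*} [AddCommGroup G] [DecidableEq G]
    (D : Finset G) : khopSet (D : Set G) 2 ⊆ twoHopCover D := by
  rintro x ⟨hx, l, hl, a, b, h, rfl⟩
  interval_cases l
  · simp at hx
  · rw [Fin.sum_univ_one]
    exact sub_mem_twoHopCover (h 0).1 (h 0).2.1 (h 0).2.2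
  · rw [Fin.sum_univ_two] at hx ⊢
    exact sub_add_sub_mem_twoHopCover (h 0).1 (h 0).2.1 (h 1).1 (h 1).2.1 (h 0).2.2 (h 1).2.2 hx

theorem card_twoHopCover_le {G : Type*} [AddCommGroup G] [DecidableEq G] (D : Finset G) :
    (twoHopCover D).card ≤ D.card.choose 2 * (D.card - 2).choose 2 +
      (D.card * (D.card - 1).choose 2 + (D.card * (D.card - 1).choose 2 +
        ((D.card * D.card - D.card) + (D.card * D.card - D.card)))) := by
  have hP : ((D.powersetCard 2).sigma fun P => (D \ P).powersetCard 2).card =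
      D.card.choose 2 * (D.card - 2).choose 2 := by
    rw [Finset.card_sigma, Finset.sum_const_nat (m := (D.card - 2).choose 2),
      Finset.card_powersetCard]
    intro P hP
    rw [Finset.mem_powersetCard] at hP
    rw [Finset.card_powersetCard, Finset.card_sdiff_of_subset hP.1, hP.2]
  have hE : (D.sigma fun a => (D.erase a).powersetCard 2).card =
      D.card * (D.card - 1).choose 2 := by
    rw [Finset.card_sigma, Finset.sum_const_nat]
    intro a ha
    rw [Finset.card_powersetCard, Finset.card_erase_of_mem ha]
  rw [← hP, ← hE, ← Finset.offDiag_card, twoHopCover]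
  iterate 4 refine (Finset.card_union_le _ _).trans (add_le_add Finset.card_image_le ?_)
  exact Finset.card_image_le

theorem stmt8 (m : ℕ) (D : Finset (ℤ × ℤ)) (hcard : D.card = m)
    (hdd : HasDistinctDifferences (↑D : Set (ℤ × ℤ))) :
    (Ck (↑D : Set (ℤ × ℤ)) 2 : ℚ) ≤
      (1 / 4) * m * (m - 1) * (m - 2) * (m - 3) + m * (m - 1) * (m - 2) + 2 * m * (m - 1) ∧
    ((1 / 4 : ℚ) * m * (m - 1) * (m - 2) * (m - 3) + m * (m - 1) * (m - 2) + 2 * m * (m - 1)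
      = (1 / 4) * m * (m - 1) * (m ^ 2 - m + 6)) := by
  refine ⟨?_, by ring⟩
  have h : Ck (D : Set (ℤ × ℤ)) 2 ≤ (twoHopCover D).card := by
    rw [← Set.ncard_coe_finset]
    exact Set.ncard_le_ncard (khopSet_two_subset_twoHopCover D) (Finset.finite_toSet _)
  replace h := h.trans (card_twoHopCover_le D)
  rw [hcard] at h
  refine (Nat.cast_le (α := ℚ).2 h).trans (le_of_eq ?_)
  rcases m with _ | _ | n
  · simp
  · simp
  · have hn : (n + 1 + 1) * (n + 1 + 1) - (n + 1 + 1) = (n + 2) * (n + 1) := by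
      rw [Nat.sub_eq_iff_eq_add (by nlinarith)]
      ring
    rw [hn, Nat.add_sub_cancel, show n + 1 + 1 - 2 = n from rfl]
    push_cast [Nat.cast_choose_two]
    ring
end

section
/- Let m ≥ 2 and k ≥ 1 be integers and let D be a set of m points in ℤ² whose pairwise differences between distinct points are all distinct (a DD(m)). Then C_k(D) ≥ k·m·(m−1), i.e. at least k·m·(m−1) distinct nonzero vectors of ℤ² can be expressed as a sum of at most k difference vectors of D. -/
open scoped Pointwise

/-- Sums of `k` differences that may be trivial are sums of at most `k` nontrivial ones. -/
lemma exists_sum_of_mem_nsmul_sub {G : Type*} [AddCommGroup G] [DecidableEq G] (D : Finset G)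
    (k : ℕ) {x : G} (hx : x ∈ k • (D - D)) :
    ∃ ℓ : ℕ, ℓ ≤ k ∧ ∃ a b : Fin ℓ → G,
      (∀ i, a i ∈ D ∧ b i ∈ D ∧ a i ≠ b i) ∧ x = ∑ i, (a i - b i) := by
  induction k generalizing x with
  | zero =>
    obtain rfl : x = 0 := by simpa using hx
    exact ⟨0, le_rfl, 0, 0, fun i => i.elim0, by simp⟩
  | succ k ih =>
    rw [succ_nsmul'] at hx
    obtain ⟨d, hd, y, hy, rfl⟩ := Finset.mem_add.1 hx
    obtain ⟨v, hv, w, hw, rfl⟩ := Finset.mem_sub.1 hd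
    obtain ⟨ℓ, hℓ, a, b, hab, rfl⟩ := ih hy
    by_cases hvw : v = w
    · exact ⟨ℓ, hℓ.trans k.le_succ, a, b, hab, by simp [hvw]⟩
    · refine ⟨ℓ + 1, Nat.succ_le_succ hℓ, Fin.cons v a, Fin.cons w b, ?_, ?_⟩
      · exact Fin.cases ⟨hv, hw, hvw⟩ hab
      · simp only [Fin.sum_univ_succ, Fin.cons_zero, Fin.cons_succ]

lemma khopSet_eq_nsmul_sub_erase {G : Type*} [AddCommGroup G] [DecidableEq G] {D : Finset G}
    (hD : D.Nonempty) (k : ℕ) :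
    khopSet (D : Set G) k = ((k • (D - D)).erase 0 : Finset G) := by
  ext x
  simp only [khopSet, Set.mem_ofPred_eq, Finset.mem_coe, Finset.mem_erase]
  refine and_congr_right fun _ => ⟨?_, exists_sum_of_mem_nsmul_sub D k⟩
  rintro ⟨ℓ, hℓ, a, b, hab, rfl⟩
  refine Finset.nsmul_subset_nsmul_right (by simpa using hD.ne_empty) hℓ ?_
  refine Finset.mem_nsmul.2 ⟨fun i => ⟨a i - b i, ?_⟩, List.sum_ofFn⟩
  exact Finset.sub_mem_sub (hab i).1 (hab i).2.1

lemma mul_pred_card_lt_card_nsmul {G : Type*} [AddGroup G] [IsAddTorsionFree G] [DecidableEq G]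
    {A : Finset G} (hA : A.Nonempty) (k : ℕ) : k * (A.card - 1) < (k • A).card := by
  induction k with
  | zero => simp
  | succ k ih =>
    have h := cauchy_davenport_of_isAddTorsionFree (hA.nsmul (n := k)) hA
    rw [← succ_nsmul] at h
    have := hA.card_pos
    rw [Nat.succ_mul]
    omega

lemma HasDistinctDifferences.card_sub {G : Type*} [AddCommGroup G] [DecidableEq G] {D : Finset G}
    (hD : HasDistinctDifferences (D : Set G)) :
    D.card * (D.card - 1) ≤ (D - D).card - 1 := by
  have h : (D.offDiag.image fun p => p.1 - p.2) ⊆ (D - D).erase 0 := by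
    intro x hx
    obtain ⟨p, hp, rfl⟩ := Finset.mem_image.1 hx
    obtain ⟨h₁, h₂, h₃⟩ := Finset.mem_offDiag.1 hp
    exact Finset.mem_erase.2 ⟨sub_ne_zero.2 h₃, Finset.sub_mem_sub h₁ h₂⟩
  have hinj : Set.InjOn (fun p : G × G => p.1 - p.2) D.offDiag := by
    intro p hp q hq hpq
    obtain ⟨h₁, h₂, h₃⟩ := Finset.mem_offDiag.1 hp
    obtain ⟨h₄, h₅, h₆⟩ := Finset.mem_offDiag.1 hq
    exact Prod.ext_iff.2 (hD _ h₁ _ h₂ _ h₄ _ h₅ h₃ h₆ hpq)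
  rcases D.eq_empty_or_nonempty with rfl | hne
  · simp
  have h0 : (0 : G) ∈ D - D := by simpa using hne.ne_empty
  have := Finset.card_le_card h
  rwa [Finset.card_image_of_injOn hinj, Finset.offDiag_card, Finset.card_erase_of_mem h0,
    ← Nat.mul_sub_one] at this

theorem stmt14 (m k : ℕ) (hm : 2 ≤ m) (hk : 1 ≤ k) (D : Finset (ℤ × ℤ))
    (hcard : D.card = m) (hdd : HasDistinctDifferences (↑D : Set (ℤ × ℤ))) :
    k * m * (m - 1) ≤ Ck (↑D : Set (ℤ × ℤ)) k := by
  subst hcard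
  have hD : D.Nonempty := Finset.card_pos.1 (by omega)
  rw [Ck, khopSet_eq_nsmul_sub_erase hD, Set.ncard_coe_finset, mul_assoc]
  calc k * (D.card * (D.card - 1)) ≤ k * ((D - D).card - 1) :=
        Nat.mul_le_mul_left k hdd.card_sub
    _ ≤ (k • (D - D)).card - 1 :=
        Nat.le_sub_one_of_lt (mul_pred_card_lt_card_nsmul (hD.sub hD) k)
    _ ≤ _ := Finset.pred_card_le_card_erase
end

section
/- Let k ≥ 2 and m ≥ 2 be integers and let D be a set of m points in ℤ² whose pairwise differences between distinct points are all distinct (a DD(m)). Then C_k(D) = k·m·(m−1) if and only if D is equivalent to a perfect Golomb ruler, i.e. there exist vectors r, s ∈ ℤ² with s ≠ 0 and a perfect Golomb ruler M ⊆ ℤ of size m such that D = {r + i·s : i ∈ M}. -/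
/-- A Golomb ruler: all differences of distinct pairs are distinct. -/
def IsGolombRuler (M : Finset ℤ) : Prop :=
  ∀ x ∈ M, ∀ y ∈ M, ∀ x' ∈ M, ∀ y' ∈ M,
    x ≠ y → x' ≠ y' → x - y = x' - y' → x = x' ∧ y = y'

/-- A perfect Golomb ruler of size m: a Golomb ruler whose set of differences
is exactly `{i : |i| ≤ m(m−1)/2}` (stated as `2|i| ≤ m(m−1)`). -/
def IsPerfectGolombRuler (M : Finset ℤ) : Prop :=
  IsGolombRuler M ∧
    {i : ℤ | ∃ u ∈ M, ∃ v ∈ M, i = u - v} =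
      {i : ℤ | 2 * |i| ≤ (M.card : ℤ) * ((M.card : ℤ) - 1)}

open scoped Pointwise

/-- Equality case of `|S + S| ≥ 2|S| - 1` in a linearly ordered group. -/
theorem exists_arithmetic_progression_of_card_add_self_le {G : Type*} [AddCommGroup G]
    [LinearOrder G] [IsOrderedAddMonoid G] [DecidableEq G] (S : Finset G) (n : ℕ) (hS : S.card = n + 1)
    (h : (S + S).card ≤ 2 * n + 1) :
    ∃ a d : G, S = (Finset.range (n + 1)).image fun i : ℕ => a + i • d := by
  obtain ⟨f, hf, hfS⟩ : ∃ f : ℕ → G, (∀ i j, i < j → j ≤ n → f i < f j) ∧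
      S = (Finset.range (n + 1)).image f := by
    refine ⟨fun i => if hi : i < n + 1 then S.orderEmbOfFin hS ⟨i, hi⟩ else 0, ?_, ?_⟩
    · intro i j hij hj
      simp only [show i < n + 1 by omega, show j < n + 1 by omega, dif_pos]
      exact (S.orderEmbOfFin hS).strictMono hij
    · ext x
      rw [← Finset.mem_coe, ← Finset.range_orderEmbOfFin S hS]
      simp only [Set.mem_range, Finset.mem_image, Finset.mem_range]
      constructor
      · rintro ⟨i, rfl⟩
        exact ⟨i, i.2, dif_pos i.2⟩
      · rintro ⟨i, hi, rfl⟩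
        exact ⟨⟨i, hi⟩, by rw [dif_pos hi]⟩
  have hmem : ∀ i, i ≤ n → f i ∈ S := fun i hi => by
    rw [hfS]
    exact Finset.mem_image_of_mem _ (Finset.mem_range.2 (by omega))
  have hle : ∀ i j, i ≤ j → j ≤ n → f i ≤ f j := fun i j hij hj => by
    rcases hij.eq_or_lt with rfl | hij
    · exact le_rfl
    · exact (hf i j hij hj).le
  set c : ℕ → G := fun j => f (j / 2) + f ((j + 1) / 2) with hc
  have hcmono : ∀ i j, i < j → j ≤ 2 * n → c i < c j := by
    intro i j hij hj
    rcases Nat.lt_or_ge (i / 2) (j / 2) with h' | h'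
    · exact add_lt_add_of_lt_of_le (hf _ _ h' (by omega)) (hle _ _ (by omega) (by omega))
    · exact add_lt_add_of_le_of_lt (hle _ _ (by omega) (by omega)) (hf _ _ (by omega) (by omega))
  have hcS : (Finset.range (2 * n + 1)).image c = S + S := by
    apply Finset.eq_of_subset_of_card_le
    · intro x hx
      simp only [Finset.mem_image, Finset.mem_range] at hx
      obtain ⟨j, hj, rfl⟩ := hx
      exact Finset.add_mem_add (hmem _ (by omega)) (hmem _ (by omega))
    · rw [Finset.card_image_of_injOn, Finset.card_range]
      · exact h
      · intro i hi j hj hij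
        simp only [Finset.coe_range, Set.mem_Iio] at hi hj
        rcases lt_trichotomy i j with h' | h' | h'
        · exact absurd hij (hcmono i j h' (by omega)).ne
        · exact h'
        · exact absurd hij (hcmono j i h' (by omega)).ne'
  have hstep : ∀ i, i + 2 ≤ n → f i + f (i + 2) = f (i + 1) + f (i + 1) := by
    intro i hi
    have hx : f i + f (i + 2) ∈ S + S :=
      Finset.add_mem_add (hmem _ (by omega)) (hmem _ (by omega))
    rw [← hcS] at hx
    simp only [Finset.mem_image, Finset.mem_range] at hx
    obtain ⟨j, hj, hj'⟩ := hx
    have hlow : c (2 * i + 1) < c j := by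
      rw [hj', hc]
      simp only [show (2 * i + 1) / 2 = i by omega, show (2 * i + 1 + 1) / 2 = i + 1 by omega]
      exact add_lt_add_right (hf _ _ (by omega) hi) _
    have hhigh : c j < c (2 * i + 3) := by
      rw [hj', hc]
      simp only [show (2 * i + 3) / 2 = i + 1 by omega,
        show (2 * i + 3 + 1) / 2 = i + 2 by omega]
      exact add_lt_add_left (hf _ _ (by omega) (by omega)) _
    have h1 : 2 * i + 1 < j := by
      by_contra! h'
      rcases h'.eq_or_lt with rfl | h'
      · exact lt_irrefl _ hlow
      · exact lt_asymm hlow (hcmono _ _ h' (by omega))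
    have h2 : j < 2 * i + 3 := by
      by_contra! h'
      rcases h'.eq_or_lt with rfl | h'
      · exact lt_irrefl _ hhigh
      · exact lt_asymm hhigh (hcmono _ _ h' (by omega))
    obtain rfl : j = 2 * i + 2 := by omega
    rw [← hj', hc]
    simp only [show (2 * i + 2) / 2 = i + 1 by omega, show (2 * i + 2 + 1) / 2 = i + 1 by omega]
  have hdiff : ∀ i, i + 1 ≤ n → f (i + 1) = f i + (f 1 - f 0) := by
    intro i
    induction i with
    | zero => intro _; simp
    | succ i ih =>
      intro hi
      have h1 := hstep i hi
      have h2 := ih (by omega)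
      have h3 : f (i + 2) = f (i + 1) + f (i + 1) - f i := by rw [← h1]; abel
      rw [h3, add_sub_assoc]
      congr 1
      rw [h2]; abel
  have hlin : ∀ i, i ≤ n → f i = f 0 + i • (f 1 - f 0) := by
    intro i
    induction i with
    | zero => intro _; simp
    | succ i ih =>
      intro hi
      rw [hdiff i hi, ih (by omega), add_assoc, succ_nsmul]
  refine ⟨f 0, f 1 - f 0, ?_⟩
  rw [hfS]
  refine Finset.image_congr fun i hi => ?_
  simp only [Finset.coe_range, Set.mem_Iio] at hi
  exact hlin i (by omega)

/-- A symmetric arithmetic progression through the origin is centred at the origin. -/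
theorem eq_image_Icc_zsmul_of_symmetric {G : Type*} [AddCommGroup G] [DecidableEq G]
    [IsAddTorsionFree G] (S : Finset G) (N : ℕ) (hS : S.card = 2 * N + 1) (h0 : (0 : G) ∈ S)
    (hneg : ∀ x ∈ S, -x ∈ S) (a d : G)
    (h : S = (Finset.range (2 * N + 1)).image fun i : ℕ => a + i • d) :
    S = (Finset.Icc (-(N : ℤ)) N).image fun i : ℤ => i • d := by
  rcases eq_or_ne d 0 with rfl | hd
  · have hsub : S ⊆ {a} := by
      rw [h]
      intro x hx
      simp only [smul_zero, add_zero, Finset.mem_image] at hx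
      obtain ⟨_, _, rfl⟩ := hx
      simp
    have hle := Finset.card_le_card hsub
    rw [hS, Finset.card_singleton] at hle
    obtain rfl : N = 0 := by omega
    obtain ⟨b, hb⟩ := Finset.card_eq_one.1 hS
    subst hb
    simpa [eq_comm] using h0
  have hinj : Function.Injective fun i : ℤ => i • d := smul_left_injective ℤ hd
  have hmem : ∀ x, x ∈ S ↔ ∃ i : ℕ, i < 2 * N + 1 ∧ a + i • d = x := by
    intro x
    rw [h]
    simp
  obtain ⟨j, hj, hj0⟩ := (hmem 0).1 h0
  have ha : a = (-(j : ℤ)) • d := by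
    rw [neg_smul, natCast_zsmul]
    exact eq_neg_of_add_eq_zero_left hj0
  have hmem' : ∀ i : ℤ, i • d ∈ S ↔ -(j : ℤ) ≤ i ∧ i ≤ 2 * N - j := by
    intro i
    rw [hmem]
    constructor
    · rintro ⟨l, hl, hli⟩
      rw [ha, ← natCast_zsmul, ← add_smul] at hli
      have := hinj hli
      omega
    · rintro ⟨h1, h2⟩
      refine ⟨(i + j).toNat, by omega, ?_⟩
      rw [ha, ← natCast_zsmul, ← add_smul]
      congr 1
      omega
  have hjN : (j : ℤ) = N := by
    have h1 := hneg _ ((hmem' (-(j : ℤ))).2 (by omega))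
    have h2 := hneg _ ((hmem' (2 * N - j : ℤ)).2 (by omega))
    rw [← neg_smul, hmem'] at h1 h2
    omega
  ext x
  simp only [Finset.mem_image, Finset.mem_Icc]
  constructor
  · intro hx
    obtain ⟨i, hi, rfl⟩ := (hmem x).1 hx
    refine ⟨i - j, by omega, ?_⟩
    rw [ha, ← natCast_zsmul, ← add_smul]
    congr 1
    omega
  · rintro ⟨i, hi, rfl⟩
    exact (hmem' i).2 (by omega)

/-- The `k`-fold sumset of `S`. -/
def iteratedSumset {G : Type*} [AddCommGroup G] [DecidableEq G] (S : Finset G) : ℕ → Finset G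
  | 0 => {0}
  | k + 1 => iteratedSumset S k + S

theorem iteratedSumset_nonempty {G : Type*} [AddCommGroup G] [DecidableEq G] {S : Finset G}
    (hS : S.Nonempty) (k : ℕ) : (iteratedSumset S k).Nonempty := by
  induction k with
  | zero => exact Finset.singleton_nonempty 0
  | succ k ih => exact ih.add hS

theorem card_add_mul_le_card_iteratedSumset {G : Type*} [AddCommGroup G] [DecidableEq G]
    [IsAddTorsionFree G] {S : Finset G} {n : ℕ} (hS : S.card = n + 1) (k j : ℕ) :
    (iteratedSumset S k).card + j * n ≤ (iteratedSumset S (k + j)).card := by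
  have hne : S.Nonempty := Finset.card_pos.1 (by omega)
  induction j with
  | zero => simp
  | succ j ih =>
    have := cauchy_davenport_of_isAddTorsionFree (iteratedSumset_nonempty hne (k + j)) hne
    rw [← add_assoc, iteratedSumset, Nat.add_mul]
    omega

theorem iteratedSumset_image_Icc_zsmul {G : Type*} [AddCommGroup G] [DecidableEq G] (d : G)
    (N k : ℕ) :
    iteratedSumset ((Finset.Icc (-(N : ℤ)) N).image fun i : ℤ => i • d) k =
      (Finset.Icc (-((k * N : ℕ) : ℤ)) (k * N : ℕ)).image fun i : ℤ => i • d := by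
  induction k with
  | zero => simp [iteratedSumset]
  | succ k ih =>
    rw [iteratedSumset, ih, Nat.add_mul, one_mul]
    generalize k * N = P
    ext x
    simp only [Finset.mem_add, Finset.mem_image, Finset.mem_Icc]
    constructor
    · rintro ⟨_, ⟨i, hi, rfl⟩, _, ⟨j, hj, rfl⟩, rfl⟩
      exact ⟨i + j, by omega, add_smul i j d⟩
    · rintro ⟨i, hi, rfl⟩
      refine ⟨_, ⟨i - max (-(N : ℤ)) (min N i), by omega, rfl⟩, _,
        ⟨max (-(N : ℤ)) (min N i), by omega, rfl⟩, ?_⟩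
      rw [← add_smul, sub_add_cancel]

theorem mem_iteratedSumset_sub_iff {G : Type*} [AddCommGroup G] [DecidableEq G] {D : Finset G}
    (hD : D.Nonempty) (k : ℕ) (x : G) :
    x ∈ iteratedSumset (D - D) k ↔ ∃ ℓ : ℕ, ℓ ≤ k ∧ ∃ a b : Fin ℓ → G,
      (∀ i, a i ∈ D ∧ b i ∈ D ∧ a i ≠ b i) ∧ x = ∑ i, (a i - b i) := by
  induction k generalizing x with
  | zero =>
    simp only [iteratedSumset, Finset.mem_singleton]
    constructor
    · rintro rfl
      exact ⟨0, le_rfl, Fin.elim0, Fin.elim0, fun i => i.elim0, by simp⟩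
    · rintro ⟨ℓ, hℓ, a, b, -, rfl⟩
      obtain rfl : ℓ = 0 := by omega
      simp
  | succ k ih =>
    rw [iteratedSumset, Finset.mem_add]
    constructor
    · rintro ⟨y, hy, z, hz, rfl⟩
      obtain ⟨ℓ, hℓ, a, b, hab, rfl⟩ := (ih y).1 hy
      obtain ⟨u, hu, v, hv, rfl⟩ := Finset.mem_sub.1 hz
      by_cases huv : u = v
      · exact ⟨ℓ, by omega, a, b, hab, by simp [huv]⟩
      · refine ⟨ℓ + 1, by omega, Fin.snoc a u, Fin.snoc b v, fun i => ?_, ?_⟩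
        · refine Fin.lastCases ?_ (fun i => ?_) i
          · simpa using ⟨hu, hv, huv⟩
          · simpa using hab i
        · simp only [Fin.sum_univ_castSucc, Fin.snoc_castSucc, Fin.snoc_last]
    · rintro ⟨ℓ, hℓ, a, b, hab, rfl⟩
      obtain ⟨w, hw⟩ := hD
      cases ℓ with
      | zero =>
        refine ⟨0, (ih 0).2 ⟨0, by omega, a, b, hab, by simp⟩, 0, ?_, by simp⟩
        exact Finset.mem_sub.2 ⟨w, hw, w, hw, sub_self w⟩
      | succ ℓ =>
        rw [Fin.sum_univ_castSucc]
        refine ⟨_, (ih _).2 ⟨ℓ, by omega, fun i => a i.castSucc, fun i => b i.castSucc,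
          fun i => hab _, rfl⟩, _, ?_, rfl⟩
        exact Finset.sub_mem_sub (hab _).1 (hab _).2.1

theorem Ck_add_one {G : Type*} [AddCommGroup G] [DecidableEq G] {D : Finset G}
    (hD : D.Nonempty) (k : ℕ) : Ck (↑D : Set G) k + 1 = (iteratedSumset (D - D) k).card := by
  have h0 : (0 : G) ∈ iteratedSumset (D - D) k :=
    (mem_iteratedSumset_sub_iff hD k 0).2
      ⟨0, by omega, Fin.elim0, Fin.elim0, fun i => i.elim0, by simp⟩
  have hset : khopSet (↑D : Set G) k = ↑((iteratedSumset (D - D) k).erase 0) := by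
    ext x
    simp only [khopSet, Set.mem_ofPred_eq, Finset.coe_erase, Set.mem_sdiff, Finset.mem_coe,
      Set.mem_singleton_iff, mem_iteratedSumset_sub_iff hD, and_comm]
  rw [Ck, hset, Set.ncard_coe_finset, Finset.card_erase_add_one h0]

theorem HasDistinctDifferences.card_sub_self {G : Type*} [AddCommGroup G] [DecidableEq G]
    {D : Finset G} (hD : D.Nonempty) (h : HasDistinctDifferences (↑D : Set G)) :
    (D - D).card = D.card * (D.card - 1) + 1 := by
  have heq : D - D = insert 0 (D.offDiag.image fun p => p.1 - p.2) := by
    ext x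
    simp only [Finset.mem_sub, Finset.mem_insert, Finset.mem_image, Finset.mem_offDiag,
      Prod.exists]
    constructor
    · rintro ⟨u, hu, v, hv, rfl⟩
      by_cases huv : u = v
      · exact Or.inl (sub_eq_zero.2 huv)
      · exact Or.inr ⟨u, v, ⟨hu, hv, huv⟩, rfl⟩
    · rintro (rfl | ⟨u, v, ⟨hu, hv, -⟩, rfl⟩)
      · obtain ⟨w, hw⟩ := hD
        exact ⟨w, hw, w, hw, sub_self w⟩
      · exact ⟨u, hu, v, hv, rfl⟩
  rw [heq, Finset.card_insert_of_notMem, Finset.card_image_of_injOn, Finset.offDiag_card,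
    Nat.mul_sub_one]
  · rintro ⟨u, v⟩ hp ⟨u', v'⟩ hp' he
    simp only [Finset.coe_offDiag, Set.mem_offDiag] at hp hp'
    obtain ⟨h1, h2⟩ := h u hp.1 v hp.2.1 u' hp'.1 v' hp'.2.1 hp.2.2 hp'.2.2 he
    rw [h1, h2]
  · simp only [Finset.mem_image, Finset.mem_offDiag, Prod.exists, not_exists, not_and]
    rintro u v ⟨-, -, huv⟩ he
    exact huv (sub_eq_zero.1 he)

/-- A distinct difference configuration whose difference set is a centred arithmetic progression
is equivalent to a perfect Golomb ruler. -/
theorem exists_perfect_golomb_ruler {G : Type*} [AddCommGroup G] [DecidableEq G]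
    [IsAddTorsionFree G] {D : Finset G} (hD : D.Nonempty)
    (hdd : HasDistinctDifferences (↑D : Set G)) {N : ℕ} (hN : 2 * N = D.card * (D.card - 1))
    {s : G} (hs : s ≠ 0) (h : D - D = (Finset.Icc (-(N : ℤ)) N).image fun i : ℤ => i • s) :
    ∃ (r : G) (M : Finset ℤ), M.card = D.card ∧ IsPerfectGolombRuler M ∧
      (↑D : Set G) = (fun i : ℤ => r + i • s) '' ↑M := by
  obtain ⟨r, hr⟩ := hD
  have hinj : Function.Injective fun i : ℤ => i • s := smul_left_injective ℤ hs
  have hinj' : Function.Injective fun i : ℤ => r + i • s := (add_right_injective r).comp hinj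
  have hmem : ∀ i : ℤ, i • s ∈ D - D ↔ -(N : ℤ) ≤ i ∧ i ≤ N := by
    intro i
    rw [h, hinj.mem_finset_image, Finset.mem_Icc]
  set M := (Finset.Icc (-(N : ℤ)) N).filter fun i => r + i • s ∈ D with hM
  have hMD : ∀ i, i ∈ M → r + i • s ∈ D := fun i hi => (Finset.mem_filter.1 hi).2
  have hDM : ∀ v ∈ D, ∃ i ∈ M, r + i • s = v := by
    intro v hv
    have hvr : v - r ∈ D - D := Finset.sub_mem_sub hv hr
    rw [h, Finset.mem_image] at hvr
    obtain ⟨i, hi, hi'⟩ := hvr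
    have hv' : r + i • s = v := by
      rw [hi']
      abel
    exact ⟨i, Finset.mem_filter.2 ⟨hi, hv'.symm ▸ hv⟩, hv'⟩
  have himg : D = M.image fun i : ℤ => r + i • s := by
    ext v
    rw [Finset.mem_image]
    exact ⟨hDM v, fun ⟨i, hi, hiv⟩ => hiv ▸ hMD i hi⟩
  have hcard : M.card = D.card := by
    rw [himg, Finset.card_image_of_injective _ hinj']
  refine ⟨r, M, hcard, ⟨?_, ?_⟩, ?_⟩
  · intro x hx y hy x' hx' y' hy' hxy hxy' he
    obtain ⟨h1, h2⟩ := hdd _ (hMD x hx) _ (hMD y hy) _ (hMD x' hx') _ (hMD y' hy')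
      (hinj'.ne hxy) (hinj'.ne hxy')
      (by rw [add_sub_add_left_eq_sub, add_sub_add_left_eq_sub, ← sub_smul, ← sub_smul, he])
    exact ⟨hinj' h1, hinj' h2⟩
  · have hN' : ((M.card : ℤ) * ((M.card : ℤ) - 1)) = 2 * N := by
      have hpos : 1 ≤ D.card := Finset.card_pos.2 ⟨r, hr⟩
      rw [hcard]
      have := congrArg (Nat.cast : ℕ → ℤ) hN
      push_cast [Nat.cast_sub hpos] at this
      linarith
    ext i
    have hi : 2 * |i| ≤ 2 * (N : ℤ) ↔ -(N : ℤ) ≤ i ∧ i ≤ N := by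
      rw [← abs_le]
      omega
    rw [hN', Set.mem_ofPred_eq, Set.mem_ofPred_eq, hi, ← hmem]
    constructor
    · rintro ⟨u, hu, v, hv, rfl⟩
      rw [sub_smul, ← add_sub_add_left_eq_sub _ _ r]
      exact Finset.sub_mem_sub (hMD u hu) (hMD v hv)
    · intro hi'
      obtain ⟨v, hv, w, hw, hvw⟩ := Finset.mem_sub.1 hi'
      obtain ⟨p, hp, rfl⟩ := hDM v hv
      obtain ⟨q, hq, rfl⟩ := hDM w hw
      rw [add_sub_add_left_eq_sub, ← sub_smul] at hvw
      exact ⟨p, hp, q, hq, (hinj hvw).symm⟩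
  · conv_lhs => rw [himg]
    rw [Finset.coe_image]

/-- The difference set of a translate of a dilate of a perfect Golomb ruler. -/
theorem IsPerfectGolombRuler.sub_self_eq {G : Type*} [AddCommGroup G] [DecidableEq G]
    {M : Finset ℤ} (hM : IsPerfectGolombRuler M) {N : ℕ}
    (hN : (2 * N : ℤ) = (M.card : ℤ) * ((M.card : ℤ) - 1)) {D : Finset G} {r s : G}
    (hD : (↑D : Set G) = (fun i : ℤ => r + i • s) '' ↑M) :
    D - D = (Finset.Icc (-(N : ℤ)) N).image fun i : ℤ => i • s := by
  have hmem : ∀ i : ℤ, (∃ u ∈ M, ∃ v ∈ M, i = u - v) ↔ -(N : ℤ) ≤ i ∧ i ≤ N := by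
    intro i
    have h := Set.ext_iff.1 hM.2 i
    rw [Set.mem_ofPred_eq, Set.mem_ofPred_eq, ← hN] at h
    rw [h, ← abs_le]
    omega
  have hD' : ∀ v, v ∈ D ↔ ∃ i ∈ M, r + i • s = v := fun v => Set.ext_iff.1 hD v
  ext x
  simp only [Finset.mem_sub, Finset.mem_image, Finset.mem_Icc, hD', ← hmem]
  constructor
  · rintro ⟨_, ⟨p, hp, rfl⟩, _, ⟨q, hq, rfl⟩, rfl⟩
    exact ⟨p - q, ⟨p, hp, q, hq, rfl⟩, by rw [sub_smul, add_sub_add_left_eq_sub]⟩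
  · rintro ⟨_, ⟨p, hp, q, hq, rfl⟩, rfl⟩
    exact ⟨_, ⟨p, hp, rfl⟩, _, ⟨q, hq, rfl⟩, by rw [sub_smul, add_sub_add_left_eq_sub]⟩

theorem exists_arithmetic_progression_of_card_add_self_le_int_prod (S : Finset (ℤ × ℤ)) (n : ℕ)
    (hS : S.card = n + 1) (h : (S + S).card ≤ 2 * n + 1) :
    ∃ a d : ℤ × ℤ, S = (Finset.range (n + 1)).image fun i : ℕ => a + i • d :=
  @exists_arithmetic_progression_of_card_add_self_le (ℤ ×ₗ ℤ) _ _ _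
    (inferInstanceAs (DecidableEq (ℤ × ℤ))) S n hS h

theorem stmt16 (m k : ℕ) (hk : 2 ≤ k) (hm : 2 ≤ m) (D : Finset (ℤ × ℤ))
    (hcard : D.card = m) (hdd : HasDistinctDifferences (↑D : Set (ℤ × ℤ))) :
    Ck (↑D : Set (ℤ × ℤ)) k = k * m * (m - 1) ↔
      ∃ (r s : ℤ × ℤ) (M : Finset ℤ), s ≠ 0 ∧ M.card = m ∧
        IsPerfectGolombRuler M ∧
        (↑D : Set (ℤ × ℤ)) = (fun i : ℤ => r + i • s) '' ↑M := by
  have hne : D.Nonempty := Finset.card_pos.1 (by omega)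
  obtain ⟨N, hN⟩ : ∃ N, 2 * N = m * (m - 1) :=
    ⟨m * (m - 1) / 2, Nat.mul_div_cancel' (Nat.even_mul_pred_self m).two_dvd⟩
  have hNpos : 0 < N := by
    have : 0 < m * (m - 1) := Nat.mul_pos (by omega) (by omega)
    omega
  have hCk := Ck_add_one hne k
  rw [mul_assoc, ← hN]
  constructor
  · intro hC
    have hScard : (D - D).card = 2 * N + 1 := by
      rw [hdd.card_sub_self hne, hcard, hN]
    have hgrow := card_add_mul_le_card_iteratedSumset hScard 2 (k - 2)
    have htwo : iteratedSumset (D - D) 2 = (D - D) + (D - D) := by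
      simp only [iteratedSumset, Finset.singleton_zero, zero_add]
    rw [Nat.add_sub_cancel' hk, ← hCk, hC, htwo] at hgrow
    have hk' : k * (2 * N) = (k - 2) * (2 * N) + 2 * (2 * N) := by
      rw [← Nat.add_mul, Nat.sub_add_cancel hk]
    obtain ⟨a, d, had⟩ := exists_arithmetic_progression_of_card_add_self_le_int_prod
      (D - D) (2 * N) hScard (by omega)
    have hS := eq_image_Icc_zsmul_of_symmetric (D - D) N hScard
      (by
        obtain ⟨w, hw⟩ := hne
        exact Finset.mem_sub.2 ⟨w, hw, w, hw, sub_self w⟩)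
      (by
        intro x hx
        obtain ⟨u, hu, v, hv, rfl⟩ := Finset.mem_sub.1 hx
        rw [neg_sub]
        exact Finset.sub_mem_sub hv hu) a d had
    have hd : d ≠ 0 := by
      rintro rfl
      have hle : (D - D).card ≤ ({0} : Finset (ℤ × ℤ)).card := by
        refine Finset.card_le_card ?_
        rw [hS]
        intro x hx
        simpa [eq_comm] using (Finset.mem_image.1 hx).imp fun _ h => h.2
      rw [hScard, Finset.card_singleton] at hle
      omega
    obtain ⟨r, M, hM, hperf, hDM⟩ :=
      exists_perfect_golomb_ruler hne hdd (by rw [hcard, hN]) hd hS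
    exact ⟨r, d, M, hd, hM.trans hcard, hperf, hDM⟩
  · rintro ⟨r, s, M, hs, hM, hperf, hDM⟩
    have hN' : (2 * N : ℤ) = (M.card : ℤ) * ((M.card : ℤ) - 1) := by
      have := congrArg (Nat.cast : ℕ → ℤ) hN
      push_cast [Nat.cast_sub (show 1 ≤ m by omega)] at this
      rw [hM, this]
    rw [hperf.sub_self_eq hN' hDM, iteratedSumset_image_Icc_zsmul,
      Finset.card_image_of_injective _ (smul_left_injective ℤ hs), Int.card_Icc] at hCk
    have : k * (2 * N) = 2 * (k * N) := by ring
    omega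
end

section
/- Let p be a prime and let u be a unit of ℤ/pℤ of multiplicative order p − 1 (a primitive root modulo p). Define the Welch periodic array R_p = {(i,j) ∈ ℤ × ℤ : the image of i in ℤ/pℤ equals u^j}, where u^j denotes the j-th power of the unit u (defined for all j ∈ ℤ). Let d, e ∈ ℤ satisfy d ≢ 0 (mod p) and e ≢ 0 (mod p−1). If R_p contains the four points (i₁, j₁), (i₁+d, j₁+e), (i₂, j₂) and (i₂+d, j₂+e), then i₁ ≡ i₂ (mod p) and j₁ ≡ j₂ (mod p−1). -/
/-- The Welch periodic array determined by a unit `u` of `ZMod p`: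
`(i,j) ∈ R_p` iff `i ≡ u^j (mod p)`, where `u^j` is the `j`-th (integer)
power of the unit `u`. -/
def welchArray (p : ℕ) (u : (ZMod p)ˣ) : Set (ℤ × ℤ) :=
  {ij | ((ij.1 : ZMod p) = ((u ^ ij.2 : (ZMod p)ˣ) : ZMod p))}

theorem stmt17 (p : ℕ) (hp : p.Prime) (u : (ZMod p)ˣ) (hu : orderOf u = p - 1)
    (d e i₁ j₁ i₂ j₂ : ℤ)
    (hd : ¬ ((p : ℤ) ∣ d)) (he : ¬ (((p : ℤ) - 1) ∣ e))
    (hA : (i₁, j₁) ∈ welchArray p u)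
    (hB : (i₁ + d, j₁ + e) ∈ welchArray p u)
    (hA' : (i₂, j₂) ∈ welchArray p u)
    (hB' : (i₂ + d, j₂ + e) ∈ welchArray p u) :
    (p : ℤ) ∣ i₁ - i₂ ∧ ((p : ℤ) - 1) ∣ j₁ - j₂ := by
  have := Fact.mk hp
  have hord : ((orderOf u : ℕ) : ℤ) = (p : ℤ) - 1 := by
    rw [hu, Nat.cast_sub hp.one_le, Nat.cast_one]
  rw [← hord] at he ⊢
  have hw : ((u ^ e : (ZMod p)ˣ) : ZMod p) - 1 ≠ 0 := by
    rw [sub_ne_zero, ne_eq, Units.val_eq_one, ← orderOf_dvd_iff_zpow_eq_one]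
    exact he
  simp only [welchArray, Set.mem_ofPred_eq, zpow_add, Units.val_mul, Int.cast_add] at hA hB hA' hB'
  rw [← hA] at hB
  rw [← hA'] at hB'
  have hi : (i₁ : ZMod p) = i₂ := mul_right_cancel₀ hw (by linear_combination hB' - hB)
  constructor
  · rw [← ZMod.intCast_zmod_eq_zero_iff_dvd, Int.cast_sub, hi, sub_self]
  · rw [orderOf_dvd_iff_zpow_eq_one, zpow_sub, mul_inv_eq_one, Units.ext_iff, ← hA, ← hA', hi]
end

section
/- Let t ≥ 3 be an integer and let F be a finite set of integers satisfying: (a) |F| = t + 1; (b) F ⊆ {−(t−1), …, −1} ∪ {1, …, t−1} ∪ {t+1}; (c) {1, −(t−1), t+1} ⊆ F; (d) there exists i ∈ F \ {1, −(t−1), t+1} with i < 0; and (e) for every i ∈ F \ {1, −(t−1), t+1} with i > 0, the integer i − t is not in F. Then every integer γ with 1 ≤ γ ≤ t − 1 can be written as γ = j − i for some i, j ∈ F. -/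
/-- If `G` has `t - 2` elements, all of them nonzero with residue modulo `t` in `[2, t - 1]`,
and no two elements of `G` differ by `t`, then `G` meets each of these residue classes. -/
lemma mem_or_sub_mem_of_card (t : ℕ) (G : Finset ℤ) (hcard : t ≤ G.card + 2)
    (hG : ∀ i ∈ G, (2 - (t : ℤ) ≤ i ∧ i ≤ -1) ∨ (2 ≤ i ∧ i ≤ (t : ℤ) - 1))
    (hsub : ∀ i ∈ G, 0 < i → i - (t : ℤ) ∉ G)
    (r : ℤ) (hr : 2 ≤ r) (hrt : r ≤ (t : ℤ) - 1) : r ∈ G ∨ r - (t : ℤ) ∈ G := by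
  have hmaps : ∀ i ∈ G, (if 0 < i then i else i + (t : ℤ)) ∈ Finset.Icc 2 ((t : ℤ) - 1) := by
    intro i hi
    have := hG i hi
    rw [Finset.mem_Icc]
    split_ifs <;> omega
  have hinj : Set.InjOn (fun i : ℤ => if 0 < i then i else i + (t : ℤ)) G := by
    intro i hi j hj hij
    dsimp only at hij
    split_ifs at hij with h₁ h₂ h₂
    · exact hij
    · exact absurd (by rwa [hij, add_sub_cancel_right]) (hsub i hi h₁)
    · exact absurd (by rwa [← hij, add_sub_cancel_right]) (hsub j hj h₂)
    · omega
  have hsurj := Finset.surjOn_of_injOn_of_card_le _ hmaps hinj (by rw [Int.card_Icc]; omega)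
  obtain ⟨i, hi, hir⟩ := hsurj (Finset.mem_coe.2 (Finset.mem_Icc.2 ⟨hr, hrt⟩))
  dsimp only at hir
  split_ifs at hir
  · exact Or.inl (hir ▸ hi)
  · exact Or.inr (by rwa [← hir, add_sub_cancel_right])


theorem stmt18 (t : ℕ) (ht : 3 ≤ t) (F : Finset ℤ)
    (ha : F.card = t + 1)
    (hb : ∀ i ∈ F,
      (-(t : ℤ) + 1 ≤ i ∧ i ≤ -1) ∨ (1 ≤ i ∧ i ≤ (t : ℤ) - 1) ∨ i = (t : ℤ) + 1)
    (hc : (1 : ℤ) ∈ F ∧ -((t : ℤ) - 1) ∈ F ∧ (t : ℤ) + 1 ∈ F)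
    (hd : ∃ i ∈ F, i ≠ 1 ∧ i ≠ -((t : ℤ) - 1) ∧ i ≠ (t : ℤ) + 1 ∧ i < 0)
    (he : ∀ i ∈ F, i ≠ 1 → i ≠ -((t : ℤ) - 1) → i ≠ (t : ℤ) + 1 → 0 < i →
      i - (t : ℤ) ∉ F) :
    ∀ γ : ℤ, 1 ≤ γ → γ ≤ (t : ℤ) - 1 → ∃ i ∈ F, ∃ j ∈ F, γ = j - i := by
  obtain ⟨h₁, h₂, h₃⟩ := hc
  have hmem : ∀ r : ℤ, 2 ≤ r → r ≤ (t : ℤ) - 1 → r ∈ F ∨ r - (t : ℤ) ∈ F := by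
    intro r hr hrt
    have key := mem_or_sub_mem_of_card t (F \ {1, -((t : ℤ) - 1), (t : ℤ) + 1}) ?_ ?_ ?_ r hr hrt
    · exact key.imp (fun h => (Finset.mem_sdiff.1 h).1) (fun h => (Finset.mem_sdiff.1 h).1)
    · have hle := Finset.le_card_sdiff {1, -((t : ℤ) - 1), (t : ℤ) + 1} F
      have hthree : ({1, -((t : ℤ) - 1), (t : ℤ) + 1} : Finset ℤ).card ≤ 3 := Finset.card_le_three
      omega
    · intro i hi
      simp only [Finset.mem_sdiff, Finset.mem_insert, Finset.mem_singleton, not_or] at hi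
      have := hb i hi.1
      omega
    · intro i hi hpos hsub
      simp only [Finset.mem_sdiff, Finset.mem_insert, Finset.mem_singleton, not_or] at hi hsub
      exact he i hi.1 hi.2.1 hi.2.2.1 hi.2.2.2 hpos hsub.1
  intro γ hγ hγt
  rcases hγt.lt_or_eq with hlt | rfl
  · rcases hmem (γ + 1) (by omega) (by omega) with h | h
    · exact ⟨_, h₁, _, h, by ring⟩
    · exact ⟨_, h₂, _, h, by ring⟩
  · rcases hmem 2 le_rfl (by omega) with h | h
    · exact ⟨_, h, _, h₃, by ring⟩
    · exact ⟨_, h, _, h₁, by ring⟩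
end

section
/- For every prime p ≥ 5 there exists a set D ⊆ ℤ² of exactly p + 2 points, contained in the rectangle {0, 1, …, p+1} × {0, 1, …, p} (a (p+1)×(p+2) rectangle of grid points), such that: (i) all differences v − w with v, w ∈ D, v ≠ w, are pairwise distinct (D is a DD(p+2)); and (ii) every nonzero vector (d, e) ∈ ℤ² with |d| ≤ p − 1 and |e| ≤ p − 2 can be written as a sum of two difference vectors of D, i.e. (d,e) = (a − b) + (c − f) for some a, b, c, f ∈ D with a ≠ b and c ≠ f. In particular, D achieves complete two-hop coverage on a (2p−3)×(2p−1) rectangle relative to its central point. -/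
/-- In `ZMod p` there is a primitive root, phrased with integer exponents. -/
theorem exists_primitive_root_zpow (p : ℕ) [hp : Fact p.Prime] :
    ∃ g : ZMod p, g ≠ 0 ∧ (∀ n : ℤ, g ^ n = 1 ↔ (p : ℤ) - 1 ∣ n) ∧
      ∀ x : ZMod p, x ≠ 0 → ∃ n : ℤ, g ^ n = x := by
  obtain ⟨u, hu⟩ := IsCyclic.exists_generator (α := (ZMod p)ˣ)
  have hord : (orderOf u : ℤ) = (p : ℤ) - 1 := by
    rw [orderOf_eq_card_of_forall_mem_zpowers hu, Nat.card_eq_fintype_card, ZMod.card_units,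
      Nat.cast_sub hp.out.one_le, Nat.cast_one]
  refine ⟨u, u.ne_zero, fun n => ?_, fun x hx => ?_⟩
  · rw [← hord, orderOf_dvd_iff_zpow_eq_one, ← Units.val_zpow_eq_zpow_val, Units.val_eq_one]
  · obtain ⟨n, hn⟩ := Subgroup.mem_zpowers_iff.mp (hu (Units.mk0 x hx))
    exact ⟨n, by rw [← Units.val_zpow_eq_zpow_val, hn, Units.val_mk0]⟩

/-- A translate of the Welch periodic array: row `y` holds the column `X y`, and modulo
`(p, p - 1)` every vector with both entries nonzero is a difference of exactly one pair of dots. -/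
theorem exists_welch_columns (p : ℕ) (hp : p.Prime) (hp3 : 3 ≤ p) :
    ∃ X : ℤ → ℤ, X 0 = 0 ∧ X 1 = 1 ∧ (∀ y, 0 ≤ X y ∧ X y < p) ∧
      (∀ y z, (p : ℤ) ∣ X y - X z → (p : ℤ) - 1 ∣ y - z) ∧
      (∀ y z y' z' : ℤ, ¬ (p : ℤ) - 1 ∣ y - z → (p : ℤ) ∣ (X y - X z) - (X y' - X z') →
        (p : ℤ) - 1 ∣ (y - z) - (y' - z') → (p : ℤ) - 1 ∣ z - z') ∧
      (∀ d e : ℤ, ¬ (p : ℤ) ∣ d → ¬ (p : ℤ) - 1 ∣ e → ∃ y z : ℤ,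
        (0 ≤ y ∧ y < p - 1) ∧ (0 ≤ z ∧ z < p - 1) ∧
        (p : ℤ) ∣ (X y - X z) - d ∧ (p : ℤ) - 1 ∣ (y - z) - e) := by
  have : Fact p.Prime := ⟨hp⟩
  have : Fact (1 < p) := ⟨hp.one_lt⟩
  obtain ⟨g, hg0, hg1, hgs⟩ := exists_primitive_root_zpow p
  have hgne : g - 1 ≠ 0 := by
    intro h
    have := (hg1 1).mp (by rw [zpow_one]; exact sub_eq_zero.mp h)
    have := Int.le_of_dvd one_pos this
    omega
  have hper : ∀ m n : ℤ, g ^ m = g ^ n ↔ (p : ℤ) - 1 ∣ m - n := by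
    intro m n
    rw [← hg1, zpow_sub₀ hg0, div_eq_one_iff_eq (zpow_ne_zero _ hg0)]
  let f : ℤ → ZMod p := fun y => (g ^ y - 1) / (g - 1)
  have hX : ∀ y, ((((f y).val : ℕ) : ℤ) : ZMod p) = f y := fun y => by
    rw [Int.cast_natCast, ZMod.natCast_zmod_val]
  refine ⟨fun y => (f y).val, ?_, ?_, ?_, ?_, ?_, ?_⟩
  · simp [f]
  · simp [f, div_self hgne, ZMod.val_one]
  · exact fun y => ⟨Int.natCast_nonneg _, Int.ofNat_lt.mpr (ZMod.val_lt (f y))⟩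
  · intro y z h
    rw [← ZMod.intCast_zmod_eq_zero_iff_dvd] at h
    simp only [Int.cast_sub, hX] at h
    rw [← hper]
    simp only [f] at h
    field_simp at h
    linear_combination h
  · intro y z y' z' hyz hx hy
    rw [← ZMod.intCast_zmod_eq_zero_iff_dvd] at hx
    simp only [Int.cast_sub, hX, f] at hx
    have hk : g ^ (y - z) = g ^ (y' - z') := (hper _ _).mpr hy
    have hk1 : g ^ (y - z) - 1 ≠ 0 := fun h => hyz ((hg1 _).mp (sub_eq_zero.mp h))
    have e1 : g ^ y = g ^ (y - z) * g ^ z := by rw [← zpow_add₀ hg0]; simp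
    have e2 : g ^ y' = g ^ (y - z) * g ^ z' := by rw [hk, ← zpow_add₀ hg0]; simp
    rw [e1, e2] at hx
    field_simp at hx
    have : (g ^ (y - z) - 1) * (g ^ z - g ^ z') = 0 := by linear_combination hx
    rw [← hper]
    exact sub_eq_zero.mp ((mul_eq_zero.mp this).resolve_left hk1)
  · intro d e hd he
    have hd0 : (d : ZMod p) ≠ 0 := fun h => hd ((ZMod.intCast_zmod_eq_zero_iff_dvd _ _).mp h)
    have he0 : g ^ e - 1 ≠ 0 := fun h => he ((hg1 _).mp (sub_eq_zero.mp h))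
    obtain ⟨n, hn⟩ := hgs (d * (g - 1) / (g ^ e - 1))
      (div_ne_zero (mul_ne_zero hd0 hgne) he0)
    have hpos : (0 : ℤ) < p - 1 := by omega
    have hmod : ∀ m : ℤ, (p : ℤ) - 1 ∣ m % (p - 1) - m := fun m =>
      (Int.mod_modEq m _).symm.dvd
    refine ⟨(n + e) % (p - 1), n % (p - 1),
      ⟨Int.emod_nonneg _ hpos.ne', Int.emod_lt_of_pos _ hpos⟩,
      ⟨Int.emod_nonneg _ hpos.ne', Int.emod_lt_of_pos _ hpos⟩, ?_, ?_⟩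
    · rw [← ZMod.intCast_zmod_eq_zero_iff_dvd]
      simp only [Int.cast_sub, hX, f]
      rw [(hper _ _).mpr (hmod (n + e)), (hper _ _).mpr (hmod n), zpow_add₀ hg0, hn]
      field_simp
      ring
    · exact (dvd_sub (hmod (n + e)) (hmod n)).trans (dvd_of_eq (by ring))

/-- A multiple of `m` strictly between `-2 * m` and `2 * m` is `0` or `±m`. -/
theorem Int.eq_zero_or_eq_or_eq_neg_of_dvd_of_abs_lt {m a : ℤ} (h : m ∣ a)
    (h1 : -(2 * m) < a) (h2 : a < 2 * m) : a = 0 ∨ a = m ∨ a = -m := by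
  obtain ⟨k, rfl⟩ := h
  have hm : 0 < m := by linarith
  have : -2 < k := by nlinarith
  have : k < 2 := by nlinarith
  obtain rfl | rfl | rfl : k = 0 ∨ k = 1 ∨ k = -1 := by omega
  all_goals simp

theorem stmt19 (p : ℕ) (hp : p.Prime) (hp5 : 5 ≤ p) :
    ∃ D : Finset (ℤ × ℤ),
      D.card = p + 2 ∧
      (∀ v ∈ D, 0 ≤ v.1 ∧ v.1 ≤ (p : ℤ) + 1 ∧ 0 ≤ v.2 ∧ v.2 ≤ (p : ℤ)) ∧
      HasDistinctDifferences (↑D : Set (ℤ × ℤ)) ∧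
      ∀ d e : ℤ, (d, e) ≠ (0, 0) → |d| ≤ (p : ℤ) - 1 → |e| ≤ (p : ℤ) - 2 →
        ∃ a ∈ D, ∃ b ∈ D, ∃ c ∈ D, ∃ f ∈ D,
          a ≠ b ∧ c ≠ f ∧ (d, e) = (a - b) + (c - f) := by
  obtain ⟨X, X0, X1, hX, hinj, huniq, hex⟩ := exists_welch_columns p hp (by omega)
  have hq5 : (5 : ℤ) ≤ p := by exact_mod_cast hp5
  let B : Finset (ℤ × ℤ) := (Finset.Ico (0 : ℤ) (p - 1)).image fun y => (X y, y)
  let E : Finset (ℤ × ℤ) := {((p : ℤ), 0), (0, (p : ℤ) - 1), ((p : ℤ) + 1, (p : ℤ))}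
  have hB : ∀ v, v ∈ B ↔ (0 ≤ v.2 ∧ v.2 < p - 1) ∧ v.1 = X v.2 := by
    rintro ⟨x, y⟩
    simp only [B, Finset.mem_image, Finset.mem_Ico, Prod.mk.injEq]
    constructor
    · rintro ⟨z, hz, rfl, rfl⟩
      exact ⟨hz, rfl⟩
    · rintro ⟨hy, rfl⟩
      exact ⟨y, hy, rfl, rfl⟩
  have hE : ∀ v, v ∈ E ↔
      v = ((p : ℤ), 0) ∨ v = (0, (p : ℤ) - 1) ∨ v = ((p : ℤ) + 1, (p : ℤ)) := by
    simp [E]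
  have hBD : ∀ y, 0 ≤ y → y < (p : ℤ) - 1 → (X y, y) ∈ B ∪ E := fun y h1 h2 =>
    Finset.mem_union_left _ ((hB _).mpr ⟨⟨h1, h2⟩, rfl⟩)
  have m00 : ((0 : ℤ), (0 : ℤ)) ∈ B ∪ E := by
    simpa [X0] using hBD 0 le_rfl (by omega)
  have m11 : ((1 : ℤ), (1 : ℤ)) ∈ B ∪ E := by
    simpa [X1] using hBD 1 (by omega) (by omega)
  have mp0 : ((p : ℤ), (0 : ℤ)) ∈ B ∪ E := Finset.mem_union_right _ (by simp [E])
  have m0p : ((0 : ℤ), (p : ℤ) - 1) ∈ B ∪ E := Finset.mem_union_right _ (by simp [E])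
  have mpp : ((p : ℤ) + 1, (p : ℤ)) ∈ B ∪ E := Finset.mem_union_right _ (by simp [E])
  have hlift : ∀ v ∈ B ∪ E, ∃ y k l : ℤ, (0 ≤ y ∧ y < p - 1) ∧
      v.1 = X y + p * k ∧ v.2 = y + (p - 1) * l ∧
      ((k = 0 ∧ l = 0) ∨ (y = 0 ∧ k = 1 ∧ l = 0) ∨ (y = 0 ∧ k = 0 ∧ l = 1) ∨
        (y = 1 ∧ k = 1 ∧ l = 1)) := by
    intro v hv
    rcases Finset.mem_union.mp hv with h | h
    · obtain ⟨h1, h2⟩ := (hB v).mp h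
      exact ⟨v.2, 0, 0, h1, by simpa using h2, by simp, by simp⟩
    · rcases (hE v).mp h with rfl | rfl | rfl
      · exact ⟨0, 1, 0, by omega, by simp [X0], by simp, by simp⟩
      · exact ⟨0, 0, 1, by omega, by simp [X0], by simp, by simp⟩
      · exact ⟨1, 1, 1, by omega, by simp [X1, add_comm], by simp, by simp⟩
  -- The columns modulo `p` and rows modulo `p - 1` with unit differences lift to actual ones.
  have hrow : ∀ s : ℤ, ¬ (p : ℤ) - 1 ∣ s → ∃ a ∈ B ∪ E, ∃ b ∈ B ∪ E, a.1 - b.1 = 1 ∧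
      (p : ℤ) - 1 ∣ (a.2 - b.2) - s ∧ |a.2 - b.2| ≤ p - 2 := by
    intro s hs
    obtain ⟨y, z, hy, hz, hx, hyz⟩ :=
      hex 1 s (fun h => by have := Int.le_of_dvd one_pos h; omega) hs
    have h1 := hX y
    have h2 := hX z
    have habs : |y - z| ≤ (p : ℤ) - 2 := abs_le.mpr ⟨by omega, by omega⟩
    rcases Int.eq_zero_or_eq_or_eq_neg_of_dvd_of_abs_lt hx (by omega) (by omega) with h | h | h
    · exact ⟨_, hBD y hy.1 hy.2, _, hBD z hz.1 hz.2, by simp only; omega, hyz, habs⟩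
    · omega
    · have hXy : X y = 0 := by omega
      have : y = 0 := by
        have := hinj y 0 (by simp [hXy, X0])
        rcases Int.eq_zero_or_eq_or_eq_neg_of_dvd_of_abs_lt this (by omega) (by omega) <;> omega
      subst this
      exact ⟨_, mp0, _, hBD z hz.1 hz.2, by simp only; omega, hyz, habs⟩
  have hcol : ∀ r : ℤ, ¬ (p : ℤ) ∣ r → ∃ a ∈ B ∪ E, ∃ b ∈ B ∪ E, a.2 - b.2 = 1 ∧
      (p : ℤ) ∣ (a.1 - b.1) - r ∧ |a.1 - b.1| ≤ p - 1 := by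
    intro r hr
    obtain ⟨y, z, hy, hz, hx, hyz⟩ :=
      hex r 1 hr (fun h => by have := Int.le_of_dvd one_pos h; omega)
    have h1 := hX y
    have h2 := hX z
    have habs : |X y - X z| ≤ (p : ℤ) - 1 := abs_le.mpr ⟨by omega, by omega⟩
    rcases Int.eq_zero_or_eq_or_eq_neg_of_dvd_of_abs_lt hyz (by omega) (by omega) with h | h | h
    · exact ⟨_, hBD y hy.1 hy.2, _, hBD z hz.1 hz.2, by simp only; omega, hx, habs⟩
    · omega
    · obtain rfl : y = 0 := by omega
      rw [X0] at hx habs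
      exact ⟨_, m0p, _, hBD z hz.1 hz.2, by simp only; omega, hx, habs⟩
  refine ⟨B ∪ E, ?_, ?_, ?_, ?_⟩
  · have hdisj : Disjoint B E := by
      rw [Finset.disjoint_left]
      intro v hv hv'
      obtain ⟨h1, h2⟩ := (hB v).mp hv
      rcases (hE v).mp hv' with rfl | rfl | rfl
      · simp only [X0] at h2; omega
      · simp only at h1; omega
      · simp only at h1; omega
    have hcB : B.card = p - 1 := by
      rw [Finset.card_image_of_injective _ (fun a b h => (Prod.mk.inj h).2), Int.card_Ico]
      omega
    have hcE : E.card = 3 := by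
      refine Finset.card_eq_three.mpr ⟨_, _, _, ?_, ?_, ?_, rfl⟩ <;>
        · simp only [ne_eq, Prod.mk.injEq]
          omega
    rw [Finset.card_union_of_disjoint hdisj, hcB, hcE]
    omega
  · intro v hv
    rcases Finset.mem_union.mp hv with h | h
    · obtain ⟨h1, h2⟩ := (hB v).mp h
      have := hX v.2
      omega
    · rcases (hE v).mp h with rfl | rfl | rfl <;> simp only <;> omega
  · intro v hv w hw v' hv' w' hw' hvw hvw' heq
    obtain ⟨y, k, l, hy, hv1, hv2, hc⟩ := hlift v hv
    obtain ⟨z, m, n, hz, hw1, hw2, hd⟩ := hlift w hw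
    obtain ⟨y', k', l', hy', hv1', hv2', hc'⟩ := hlift v' hv'
    obtain ⟨z', m', n', hz', hw1', hw2', hd'⟩ := hlift w' hw'
    have e1 : v.1 - w.1 = v'.1 - w'.1 := congrArg Prod.fst heq
    have e2 : v.2 - w.2 = v'.2 - w'.2 := congrArg Prod.snd heq
    have hx : (p : ℤ) ∣ (X y - X z) - (X y' - X z') :=
      ⟨(k' - m') - (k - m), by linear_combination e1 - hv1 + hw1 + hv1' - hw1'⟩
    have hyz : (p : ℤ) - 1 ∣ (y - z) - (y' - z') :=
      ⟨(l' - n') - (l - n), by linear_combination e2 - hv2 + hw2 + hv2' - hw2'⟩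
    have hne : ¬(y = z ∧ k = m ∧ l = n) := by
      rintro ⟨rfl, rfl, rfl⟩
      exact hvw (Prod.ext (hv1.trans hw1.symm) (hv2.trans hw2.symm))
    have hred : ∀ a b : ℤ, (0 ≤ a ∧ a < p - 1) → (0 ≤ b ∧ b < p - 1) →
        (p : ℤ) - 1 ∣ a - b → a = b := by
      intro a b ha hb h
      rcases Int.eq_zero_or_eq_or_eq_neg_of_dvd_of_abs_lt h (by omega) (by omega) <;> omega
    have hp0 : (p : ℤ) ≠ 0 := by omega
    have hp1 : (p : ℤ) - 1 ≠ 0 := by omega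
    suffices h : (y = y' ∧ k = k' ∧ l = l') ∧ (z = z' ∧ m = m' ∧ n = n') by
      obtain ⟨⟨rfl, rfl, rfl⟩, rfl, rfl, rfl⟩ := h
      exact ⟨Prod.ext (hv1.trans hv1'.symm) (hv2.trans hv2'.symm),
        Prod.ext (hw1.trans hw1'.symm) (hw2.trans hw2'.symm)⟩
    by_cases hyz0 : y = z
    · subst hyz0
      have : y' = z' := hred _ _ hy' hz' (by
        simpa [dvd_sub_comm] using hyz)
      subst this
      have hk : k - m = k' - m' :=
        mul_left_cancel₀ hp0 (by linear_combination e1 - hv1 + hw1 + hv1' - hw1')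
      have hl : l - n = l' - n' :=
        mul_left_cancel₀ hp1 (by linear_combination e2 - hv2 + hw2 + hv2' - hw2')
      clear * - hc hd hc' hd' hk hl hne
      omega
    · have hzz : z = z' := hred _ _ hz hz'
        (huniq y z y' z' (fun h => hyz0 (hred _ _ hy hz h)) hx hyz)
      subst hzz
      have : y = y' := hred _ _ hy hy' (by convert hyz using 1; ring)
      subst this
      have hk : k - m = k' - m' :=
        mul_left_cancel₀ hp0 (by linear_combination e1 - hv1 + hw1 + hv1' - hw1')
      have hl : l - n = l' - n' :=
        mul_left_cancel₀ hp1 (by linear_combination e2 - hv2 + hw2 + hv2' - hw2')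
      clear * - hc hd hc' hd' hk hl hyz0
      omega
  · have hneg : ∀ d e : ℤ, (∃ a ∈ B ∪ E, ∃ b ∈ B ∪ E, ∃ c ∈ B ∪ E, ∃ f ∈ B ∪ E,
        a ≠ b ∧ c ≠ f ∧ (-d, -e) = (a - b) + (c - f)) →
        ∃ a ∈ B ∪ E, ∃ b ∈ B ∪ E, ∃ c ∈ B ∪ E, ∃ f ∈ B ∪ E,
        a ≠ b ∧ c ≠ f ∧ (d, e) = (a - b) + (c - f) := by
      rintro d e ⟨a, ha, b, hb, c, hc, f, hf, hab, hcf, h⟩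
      refine ⟨b, hb, a, ha, f, hf, c, hc, hab.symm, hcf.symm, ?_⟩
      rw [← neg_inj, Prod.neg_mk, h]
      abel
    have hvert : ∀ e : ℤ, 0 < e → e ≤ p - 2 →
        ∃ a ∈ B ∪ E, ∃ b ∈ B ∪ E, ∃ c ∈ B ∪ E, ∃ f ∈ B ∪ E,
        a ≠ b ∧ c ≠ f ∧ ((0 : ℤ), e) = (a - b) + (c - f) := by
      intro e he0 he
      have close : ∀ a ∈ B ∪ E, ∀ b ∈ B ∪ E, ∀ c ∈ B ∪ E, ∀ f ∈ B ∪ E,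
          a.1 - b.1 = 1 → f.1 - c.1 = 1 → e = (a.2 - b.2) + (c.2 - f.2) →
          ∃ a ∈ B ∪ E, ∃ b ∈ B ∪ E, ∃ c ∈ B ∪ E, ∃ f ∈ B ∪ E,
            a ≠ b ∧ c ≠ f ∧ ((0 : ℤ), e) = (a - b) + (c - f) := by
        intro a ha b hb c hc f hf h1 h2 h3
        refine ⟨a, ha, b, hb, c, hc, f, hf, ?_, ?_, Prod.ext ?_ h3⟩
        · rintro rfl; omega
        · rintro rfl; omega
        · simp only [Prod.fst_add, Prod.fst_sub]; omega
      have hnd : ∀ s : ℤ, s ≠ 0 → -(p - 1) < s → s < p - 1 → ¬ (p : ℤ) - 1 ∣ s := by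
        intro s h0 h1 h2 h
        rcases Int.eq_zero_or_eq_or_eq_neg_of_dvd_of_abs_lt h (by omega) (by omega) <;> omega
      by_cases h1 : e = 1
      · obtain ⟨a, ha, b, hb, hab, hdvd, habs⟩ := hrow 2 (hnd 2 (by omega) (by omega) (by omega))
        rw [abs_le] at habs
        rcases Int.eq_zero_or_eq_or_eq_neg_of_dvd_of_abs_lt hdvd (by omega) (by omega)
          with h | h | h
        · exact close a ha b hb _ m00 _ m11 hab (by simp) (by simp only; omega)
        · omega
        · exact close a ha b hb _ m0p _ m11 hab (by simp) (by simp only; omega)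
      · obtain ⟨a, ha, b, hb, hab, hdvd, habs⟩ :=
          hrow (1 - e) (hnd _ (by omega) (by omega) (by omega))
        rw [abs_le] at habs
        rcases Int.eq_zero_or_eq_or_eq_neg_of_dvd_of_abs_lt hdvd (by omega) (by omega)
          with h | h | h
        · exact close _ m11 _ m00 b hb a ha (by simp) hab (by simp only; omega)
        · exact close _ mpp _ mp0 b hb a ha (by simp) hab (by simp only; omega)
        · omega
    have hhor : ∀ d : ℤ, 0 < d → d ≤ p - 1 →
        ∃ a ∈ B ∪ E, ∃ b ∈ B ∪ E, ∃ c ∈ B ∪ E, ∃ f ∈ B ∪ E,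
        a ≠ b ∧ c ≠ f ∧ (d, (0 : ℤ)) = (a - b) + (c - f) := by
      intro d hd0 hd
      have close : ∀ a ∈ B ∪ E, ∀ b ∈ B ∪ E, ∀ c ∈ B ∪ E, ∀ f ∈ B ∪ E,
          a.2 - b.2 = 1 → f.2 - c.2 = 1 → d = (a.1 - b.1) + (c.1 - f.1) →
          ∃ a ∈ B ∪ E, ∃ b ∈ B ∪ E, ∃ c ∈ B ∪ E, ∃ f ∈ B ∪ E,
            a ≠ b ∧ c ≠ f ∧ (d, (0 : ℤ)) = (a - b) + (c - f) := by
        intro a ha b hb c hc f hf h1 h2 h3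
        refine ⟨a, ha, b, hb, c, hc, f, hf, ?_, ?_, Prod.ext h3 ?_⟩
        · rintro rfl; omega
        · rintro rfl; omega
        · simp only [Prod.snd_add, Prod.snd_sub]; omega
      have hnd : ∀ s : ℤ, s ≠ 0 → -p < s → s < p → ¬ (p : ℤ) ∣ s := by
        intro s h0 h1 h2 h
        rcases Int.eq_zero_or_eq_or_eq_neg_of_dvd_of_abs_lt h (by omega) (by omega) <;> omega
      by_cases h1 : d = 1
      · obtain ⟨a, ha, b, hb, hab, hdvd, habs⟩ := hcol 2 (hnd 2 (by omega) (by omega) (by omega))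
        rw [abs_le] at habs
        rcases Int.eq_zero_or_eq_or_eq_neg_of_dvd_of_abs_lt hdvd (by omega) (by omega)
          with h | h | h
        · exact close a ha b hb _ m00 _ m11 hab (by simp) (by simp only; omega)
        · omega
        · exact close a ha b hb _ mp0 _ m11 hab (by simp) (by simp only; omega)
      · obtain ⟨a, ha, b, hb, hab, hdvd, habs⟩ :=
          hcol (1 - d) (hnd _ (by omega) (by omega) (by omega))
        rw [abs_le] at habs
        rcases Int.eq_zero_or_eq_or_eq_neg_of_dvd_of_abs_lt hdvd (by omega) (by omega)
          with h | h | h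
        · exact close _ m11 _ m00 b hb a ha (by simp) hab (by simp only; omega)
        · exact close _ mpp _ m0p b hb a ha (by simp) hab (by simp only; omega)
        · omega
    intro d e hde hd he
    rw [abs_le] at hd he
    rcases eq_or_ne d 0 with rfl | hd0
    · have he0 : e ≠ 0 := by rintro rfl; exact hde rfl
      rcases lt_or_gt_of_ne he0 with h | h
      · exact hneg 0 e (by rw [neg_zero]; exact hvert (-e) (by omega) (by omega))
      · exact hvert e h he.2
    rcases eq_or_ne e 0 with rfl | he0
    · rcases lt_or_gt_of_ne hd0 with h | h
      · exact hneg d 0 (by rw [neg_zero]; exact hhor (-d) (by omega) (by omega))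
      · exact hhor d h hd.2
    obtain ⟨y, z, hy, hz, hx, hyz⟩ := hex d e
      (fun h => by
        rcases Int.eq_zero_or_eq_or_eq_neg_of_dvd_of_abs_lt h (by omega) (by omega) <;> omega)
      (fun h => by
        rcases Int.eq_zero_or_eq_or_eq_neg_of_dvd_of_abs_lt h (by omega) (by omega) <;> omega)
    have h1 := hX y
    have h2 := hX z
    have my := hBD y hy.1 hy.2
    have mz := hBD z hz.1 hz.2
    have hx' := Int.eq_zero_or_eq_or_eq_neg_of_dvd_of_abs_lt hx (by omega) (by omega)
    have hyz' := Int.eq_zero_or_eq_or_eq_neg_of_dvd_of_abs_lt hyz (by omega) (by omega)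
    have hne : y ≠ z := by
      rintro rfl
      omega
    have close : ∀ c ∈ B ∪ E, ∀ f ∈ B ∪ E, c ≠ f → d = (X y - X z) + (c.1 - f.1) →
        e = (y - z) + (c.2 - f.2) →
        ∃ a ∈ B ∪ E, ∃ b ∈ B ∪ E, ∃ c ∈ B ∪ E, ∃ f ∈ B ∪ E,
          a ≠ b ∧ c ≠ f ∧ (d, e) = (a - b) + (c - f) := fun c hc f hf hcf hd he =>
      ⟨_, my, _, mz, c, hc, f, hf, fun h => hne (Prod.mk.inj h).2, hcf, Prod.ext hd he⟩
    have hsplit : ∀ w ∈ B ∪ E, w.2 ≠ y → w.2 ≠ z → d = X y - X z → e = y - z →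
        ∃ a ∈ B ∪ E, ∃ b ∈ B ∪ E, ∃ c ∈ B ∪ E, ∃ f ∈ B ∪ E,
          a ≠ b ∧ c ≠ f ∧ (d, e) = (a - b) + (c - f) := by
      rintro w hw h1 h2 rfl rfl
      refine ⟨_, my, w, hw, w, hw, _, mz, ?_, ?_, ?_⟩
      · rintro rfl; exact h1 rfl
      · rintro rfl; exact h2 rfl
      · rw [sub_add_sub_cancel, Prod.mk_sub_mk]
    have np0 : ((p : ℤ), (0 : ℤ)) ≠ (0, 0) := by simp only [ne_eq, Prod.mk.injEq]; omega
    have n0p : ((0 : ℤ), (p : ℤ) - 1) ≠ (0, 0) := by simp only [ne_eq, Prod.mk.injEq]; omega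
    have npp : ((p : ℤ) + 1, (p : ℤ)) ≠ (1, 1) := by simp only [ne_eq, Prod.mk.injEq]; omega
    have nx : ((p : ℤ), (0 : ℤ)) ≠ (0, (p : ℤ) - 1) := by
      simp only [ne_eq, Prod.mk.injEq]; omega
    rcases hx' with hx' | hx' | hx' <;> rcases hyz' with hyz' | hyz' | hyz'
    · exact hsplit _ mpp (by simp only; omega) (by simp only; omega) (by omega) (by omega)
    · exact close _ m00 _ m0p n0p.symm (by simp only; omega) (by simp only; omega)
    · exact close _ m0p _ m00 n0p (by simp only; omega) (by simp only; omega)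
    · exact close _ m00 _ mp0 np0.symm (by simp only; omega) (by simp only; omega)
    · exact close _ m11 _ mpp npp.symm (by simp only; omega) (by simp only; omega)
    · exact close _ m0p _ mp0 nx.symm (by simp only; omega) (by simp only; omega)
    · exact close _ mp0 _ m00 np0 (by simp only; omega) (by simp only; omega)
    · exact close _ mp0 _ m0p nx (by simp only; omega) (by simp only; omega)
    · exact close _ mpp _ m11 npp (by simp only; omega) (by simp only; omega)
end
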